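/- Let (T,A) be a measurable cocycle over an ergodic system. For almost every x ∈ Δ, if G ⊂ ℝ^p is an affine subspace parallel to a linear subspace G₀ transverse to the central stable space E^{cs}(x), then the Hausdorff dimension of G ∩ W^s(x) is 0, where W^s(x) = {w : dist(A_n(x)·w, ℤ^p) → 0}. -/

import Mathlib

open MeasureTheory Filter Metric
open scoped ENNReal

/-- The cocycle iterates `A_n(x) = A(T^{n-1} x) ⋯ A(x)`. -/
noncomputable def cocycleIter {α : Type*} {p : ℕ} (T : α → α)
    (A : α → (EuclideanSpace ℝ (Fin p) ≃L[ℝ] EuclideanSpace ℝ (Fin p))) :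
    ℕ → α → (EuclideanSpace ℝ (Fin p) ≃L[ℝ] EuclideanSpace ℝ (Fin p))
  | 0, _ => ContinuousLinearEquiv.refl ℝ (EuclideanSpace ℝ (Fin p))
  | n + 1, x => (A x).trans (cocycleIter T A n (T x))

/-- The central stable space `E^{cs}(x) = {w : limsup ‖A_n(x)·w‖^{1/n} ≤ 1}`. -/
noncomputable def centralStable {α : Type*} {p : ℕ} (T : α → α)
    (A : α → (EuclideanSpace ℝ (Fin p) ≃L[ℝ] EuclideanSpace ℝ (Fin p))) (x : α) :
    Set (EuclideanSpace ℝ (Fin p)) :=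
  {w | limsup (fun n : ℕ => ‖cocycleIter T A n x w‖ ^ ((1 : ℝ) / n)) atTop ≤ 1}

/-- The integer lattice `ℤ^p ⊂ ℝ^p`. -/
def latticeZ (p : ℕ) : Set (EuclideanSpace ℝ (Fin p)) := {w | ∀ i, ∃ k : ℤ, w i = (k : ℝ)}

/-- The weak-stable space `W^s(x) = {w : dist (A_n(x)·w, ℤ^p) → 0}`. -/
noncomputable def weakStable {α : Type*} {p : ℕ} (T : α → α)
    (A : α → (EuclideanSpace ℝ (Fin p) ≃L[ℝ] EuclideanSpace ℝ (Fin p))) (x : α) :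
    Set (EuclideanSpace ℝ (Fin p)) :=
  {w | Tendsto (fun n : ℕ => infDist (cocycleIter T A n x w) (latticeZ p)) atTop (nhds 0)}


section ErgodicPart
open Topology

/-- auxiliary maximal function -/
noncomputable def maxSum {α : Type*} (T : α → α) (g : α → ℝ) : ℕ → α → ℝ
  | 0, _ => 0
  | n + 1, x => max 0 (g x + maxSum T g n (T x))

lemma maxSum_nonneg {α : Type*} (T : α → α) (g : α → ℝ) (n : ℕ) (x : α) : 0 ≤ maxSum T g n x := by
  cases n with
  | zero => exact le_rfl
  | succ n => exact le_max_left _ _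

lemma maxSum_le_succ {α : Type*} (T : α → α) (g : α → ℝ) (n : ℕ) :
    ∀ x, maxSum T g n x ≤ maxSum T g (n + 1) x := by
  induction n with
  | zero => intro x; exact maxSum_nonneg T g 1 x
  | succ n ih =>
    intro x
    simp only [maxSum] at ih ⊢
    exact max_le_max le_rfl (by linarith [ih (T x)])

lemma birkhoffSum_le_maxSum {α : Type*} (T : α → α) (g : α → ℝ) (n : ℕ) :
    ∀ x, birkhoffSum T g n x ≤ maxSum T g n x := by
  induction n with
  | zero => intro x; simp [maxSum]
  | succ n ih =>
    intro x
    rw [birkhoffSum_succ']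
    exact le_trans (by linarith [ih (T x)]) (le_max_right _ _)

lemma maxSum_measurable {α : Type*} [MeasurableSpace α] {T : α → α} (hT : Measurable T) {g : α → ℝ}
    (hg : Measurable g) (n : ℕ) : Measurable (maxSum T g n) := by
  induction n with
  | zero => exact measurable_const
  | succ n ih => exact measurable_const.max (hg.add (ih.comp hT))

lemma maxSum_integrable {α : Type*} [MeasurableSpace α] {μ : Measure α} [IsProbabilityMeasure μ]
    {T : α → α} (hT : MeasurePreserving T μ μ) {g : α → ℝ}
    (hg : Integrable g μ) (n : ℕ) : Integrable (maxSum T g n) μ := by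
  induction n with
  | zero => exact integrable_zero _ _ _
  | succ n ih =>
    exact (integrable_zero _ _ _).sup (hg.add (hT.integrable_comp_of_integrable ih))

theorem birkhoff_bdd {α : Type*} [MeasurableSpace α] {μ : Measure α} [IsProbabilityMeasure μ]
    {T : α → α} (hT : Ergodic T μ) {g : α → ℝ} (hgm : Measurable g) (hg : Integrable g μ)
    (hneg : ∫ x, g x ∂μ < 0) :
    ∀ᵐ x ∂μ, BddAbove (Set.range fun n => maxSum T g n x) := by
  have hmono : ∀ x, Monotone fun n => maxSum T g n x := fun x =>
    monotone_nat_of_le_succ fun n => maxSum_le_succ T g n x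
  set E : Set α := {x | ¬ BddAbove (Set.range fun n => maxSum T g n x)} with hE
  have hEm : MeasurableSet E := by
    have : E = ⋂ K : ℕ, ⋃ n : ℕ, {x | (K : ℝ) < maxSum T g n x} := by
      ext x
      simp only [hE, Set.mem_ofPred_eq, Set.mem_iInter, Set.mem_iUnion, not_bddAbove_iff,
        Set.mem_range, exists_exists_eq_and]
      constructor
      · intro h K; exact h K
      · intro h r
        obtain ⟨K, hK⟩ := exists_nat_gt r
        obtain ⟨n, hn⟩ := h K
        exact ⟨n, hK.trans hn⟩
    rw [this]
    exact MeasurableSet.iInter fun K => MeasurableSet.iUnion fun n =>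
      measurableSet_lt measurable_const (maxSum_measurable hT.measurable hgm n)
  have hEinv : T ⁻¹' E = E := by
    ext x
    simp only [hE, Set.mem_preimage, Set.mem_ofPred_eq, not_bddAbove_iff,
        Set.mem_range, exists_exists_eq_and]
    constructor
    · intro h r
      obtain ⟨n, hn⟩ := h (r - g x)
      exact ⟨n + 1, lt_of_lt_of_le (by linarith) (le_max_right _ _)⟩
    · intro h r
      obtain ⟨n, hn⟩ := h (max 0 (r + g x))
      cases n with
      | zero => exact absurd hn (not_lt.2 (le_max_left _ _))
      | succ n =>
        refine ⟨n, ?_⟩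
        simp only [maxSum] at hn
        rcases lt_max_iff.1 hn with h1 | h1
        · exact absurd h1 (not_lt.2 (le_max_left _ _))
        · have := (max_lt_iff.1 h1).2
          linarith
  rcases hT.toPreErgodic.ae_mem_or_ae_notMem hEm hEinv with h | h
  · exfalso
    have hint : ∀ n, Integrable (maxSum T g n) μ := maxSum_integrable hT.toMeasurePreserving hg
    have hlim : Tendsto (fun n => ∫ x, (maxSum T g (n+1) x - maxSum T g n (T x)) ∂μ) atTop
        (𝓝 (∫ x, g x ∂μ)) := by
      refine tendsto_integral_of_dominated_convergence (fun x => |g x|) ?_ hg.abs ?_ ?_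
      · intro n
        exact ((maxSum_measurable hT.measurable hgm _).sub
          ((maxSum_measurable hT.measurable hgm n).comp hT.measurable)).aestronglyMeasurable
      · intro n
        refine ae_of_all _ fun x => ?_
        rw [Real.norm_eq_abs]
        have h0 := maxSum_nonneg T g n (T x)
        simp only [maxSum]
        rcases le_total 0 (g x + maxSum T g n (T x)) with h1 | h1
        · rw [max_eq_right h1]; simp
        · rw [max_eq_left h1, abs_of_nonpos (by linarith), abs_of_nonpos (by linarith)]; linarith
      · filter_upwards [h] with x hx
        have hx' : T x ∈ E := by rw [← hEinv] at hx; exact hx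
        have hx'' : ∃ n, - g x < maxSum T g n (T x) := by
          simp only [hE, Set.mem_ofPred_eq, not_bddAbove_iff,
            Set.mem_range, exists_exists_eq_and] at hx'
          exact hx' _
        obtain ⟨n, hn⟩ := hx''
        refine tendsto_const_nhds.congr' ?_
        filter_upwards [eventually_ge_atTop n] with m hm
        have := hmono (T x) hm
        simp only [maxSum] at this ⊢
        rw [max_eq_right (by linarith)]; ring
    have hge : ∀ n, 0 ≤ ∫ x, (maxSum T g (n+1) x - maxSum T g n (T x)) ∂μ := by
      intro n
      have h2 : Integrable (fun x => maxSum T g n (T x)) μ :=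
        hT.toMeasurePreserving.integrable_comp_of_integrable (hint n)
      rw [integral_sub (hint _) h2]
      have h1 : ∫ x, maxSum T g n (T x) ∂μ = ∫ x, maxSum T g n x ∂μ := by
        rw [← integral_map hT.measurable.aemeasurable, hT.map_eq]
        exact (maxSum_measurable hT.measurable hgm n).aestronglyMeasurable
      rw [h1, sub_nonneg]
      exact integral_mono (hint _) (hint _) (maxSum_le_succ T g n)
    have := ge_of_tendsto' hlim hge
    linarith
  · filter_upwards [h] with x hx
    simpa [hE] using hx

theorem birkhoff_upper {α : Type*} [MeasurableSpace α] {μ : Measure α} [IsProbabilityMeasure μ]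
    {T : α → α} (hT : Ergodic T μ) {f : α → ℝ} (hfm : Measurable f) (hf : Integrable f μ)
    {c : ℝ} (hc : ∫ x, f x ∂μ < c) :
    ∀ᵐ x ∂μ, ∀ᶠ n : ℕ in atTop, birkhoffSum T f n x ≤ n * c := by
  set c' := (∫ x, f x ∂μ + c) / 2 with hc'
  have h := birkhoff_bdd hT (g := fun x => f x - c') (hfm.sub measurable_const)
    (hf.sub (integrable_const _)) (by
      rw [integral_sub hf (integrable_const _)]; simp; linarith)
  filter_upwards [h] with x hx
  obtain ⟨K, hK⟩ := hx
  have h2 : ∀ n : ℕ, birkhoffSum T f n x ≤ n * c' + K := by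
    intro n
    have h3 : maxSum T (fun x => f x - c') n x ≤ K := hK ⟨n, rfl⟩
    have h4 := birkhoffSum_le_maxSum T (fun x => f x - c') n x
    have h5 : birkhoffSum T (fun x => f x - c') n x = birkhoffSum T f n x - n * c' := by
      simp [birkhoffSum, Finset.sum_sub_distrib]
    linarith
  have h3 : ∀ᶠ n : ℕ in atTop, K ≤ n * (c - c') := by
    have : Tendsto (fun n : ℕ => (n : ℝ) * (c - c')) atTop atTop :=
      tendsto_natCast_atTop_atTop.atTop_mul_const (by linarith)
    exact this.eventually_ge_atTop K
  filter_upwards [h3] with n hn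
  linarith [h2 n]

theorem birkhoff_tendsto {α : Type*} [MeasurableSpace α] {μ : Measure α} [IsProbabilityMeasure μ]
    {T : α → α} (hT : Ergodic T μ) {f : α → ℝ} (hfm : Measurable f) (hf : Integrable f μ) :
    ∀ᵐ x ∂μ, ∀ ε > 0, ∀ᶠ n : ℕ in atTop,
      |birkhoffSum T f n x - n * ∫ x, f x ∂μ| ≤ n * ε := by
  have h1 : ∀ᵐ x ∂μ, ∀ k : ℕ, ∀ᶠ n : ℕ in atTop,
      birkhoffSum T f n x ≤ n * (∫ x, f x ∂μ + 1 / ((k : ℝ) + 1)) := by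
    rw [ae_all_iff]; intro k
    exact birkhoff_upper hT hfm hf (by have : 0 < 1 / ((k : ℝ) + 1) := by positivity
                                       linarith)
  have h2 : ∀ᵐ x ∂μ, ∀ k : ℕ, ∀ᶠ n : ℕ in atTop,
      birkhoffSum T (fun x => - f x) n x ≤ n * (∫ x, - f x ∂μ + 1 / ((k : ℝ) + 1)) := by
    rw [ae_all_iff]; intro k
    have h0 : 0 < 1 / ((k : ℝ) + 1) := by positivity
    exact birkhoff_upper hT hfm.neg hf.neg (lt_add_of_pos_right _ h0)
  filter_upwards [h1, h2] with x hx1 hx2 ε hε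
  obtain ⟨k, hk⟩ := exists_nat_one_div_lt hε
  filter_upwards [hx1 k, hx2 k] with n hn1 hn2
  have h5 : birkhoffSum T (fun x => - f x) n x = - birkhoffSum T f n x := by
    simp [birkhoffSum]
  rw [h5, integral_neg] at hn2
  have hn : (n : ℝ) * (1 / ((k : ℝ) + 1)) ≤ n * ε := by gcongr
  rw [abs_le]; constructor <;> nlinarith

lemma kingman_greedy {α : Type*} {T : α → α} {g : ℕ → α → ℝ} (hnn : ∀ n x, 0 ≤ g n x)
    (hsub : ∀ m n x, g (m + n) x ≤ g m x + g n (T^[m] x)) {c : ℝ} (hc : 0 ≤ c) (L : ℕ)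
    (B : Set α) (hB : ∀ x, x ∉ B → ∃ k, 1 ≤ k ∧ k ≤ L ∧ g k x ≤ c * k) :
    ∀ n x, 1 ≤ n → g n x ≤ c * n + birkhoffSum T (B.indicator (g 1)) n x
      + (birkhoffSum T (g 1) n x - birkhoffSum T (g 1) (n - L) x) := by
  have hSmono : ∀ (h : α → ℝ), (∀ x, 0 ≤ h x) → ∀ x, Monotone fun n => birkhoffSum T h n x := by
    intro h hh x
    refine monotone_nat_of_le_succ fun n => ?_
    rw [birkhoffSum_succ]; linarith [hh (T^[n] x)]
  have hind : ∀ x, 0 ≤ B.indicator (g 1) x := fun x => Set.indicator_nonneg (fun x _ => hnn 1 x) x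
  have hS0 : ∀ (h : α → ℝ), (∀ x, 0 ≤ h x) → ∀ x n, 0 ≤ birkhoffSum T h n x := fun h hh x n =>
    Finset.sum_nonneg fun i _ => hh _
  have hgS : ∀ n x, 1 ≤ n → g n x ≤ birkhoffSum T (g 1) n x := by
    intro n
    induction n with
    | zero => intro x h; omega
    | succ n ih =>
      intro x _
      rcases Nat.eq_zero_or_pos n with h0 | h0
      · subst h0; simp
      · rw [birkhoffSum_succ', add_comm n 1]
        refine (hsub 1 n x).trans ?_
        simpa using ih (T x) h0
  -- one recursion step
  have hstep : ∀ n k x, 1 ≤ k → k < n →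
      (g (n - k) (T^[k] x) ≤ c * (n - k : ℕ) + birkhoffSum T (B.indicator (g 1)) (n - k) (T^[k] x)
      + (birkhoffSum T (g 1) (n - k) (T^[k] x) - birkhoffSum T (g 1) (n - k - L) (T^[k] x))) →
      g n x ≤ g k x + c * n - c * k + (birkhoffSum T (B.indicator (g 1)) n x
        - birkhoffSum T (B.indicator (g 1)) k x)
      + (birkhoffSum T (g 1) n x - birkhoffSum T (g 1) (n - L) x) := by
    intro n k x hk hkn h
    have h1 := hsub k (n - k) x
    rw [Nat.add_sub_cancel' hkn.le] at h1
    have e1 := birkhoffSum_add T (g 1) k (n - k) x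
    have e2 := birkhoffSum_add T (B.indicator (g 1)) k (n - k) x
    have e3 := birkhoffSum_add T (g 1) k (n - k - L) x
    rw [Nat.add_sub_cancel' hkn.le] at e1 e2
    have e4 := hSmono (g 1) (hnn 1) x (show n - L ≤ k + (n - k - L) by omega)
    simp only at e4
    have e5 : ((n - k : ℕ) : ℝ) = n - k := by rw [Nat.cast_sub hkn.le]
    rw [e5] at h
    linarith
  intro n
  induction n using Nat.strong_induction_on with
  | _ n ih =>
    intro x hn
    have hR : 0 ≤ birkhoffSum T (g 1) n x - birkhoffSum T (g 1) (n - L) x :=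
      sub_nonneg.2 (hSmono (g 1) (hnn 1) x (Nat.sub_le n L))
    by_cases hx : x ∈ B
    · rcases Nat.eq_or_lt_of_le hn with h1 | h1
      · subst h1
        have : birkhoffSum T (B.indicator (g 1)) 1 x = g 1 x := by simp [hx]
        rw [this]; push_cast; linarith
      · have := hstep n 1 x le_rfl h1 (ih (n - 1) (by omega) _ (by omega))
        have h2 : birkhoffSum T (B.indicator (g 1)) 1 x = g 1 x := by simp [hx]
        rw [h2] at this; push_cast at this; linarith
    · obtain ⟨k, hk1, hkL, hk⟩ := hB x hx
      have hSn := hS0 _ hind x n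
      have hSk := hS0 _ hind x k
      rcases lt_trichotomy k n with h | h | h
      · have := hstep n k x hk1 h (ih (n - k) (by omega) _ (by omega))
        linarith
      · subst h; linarith
      · have h0 : n - L = 0 := by omega
        have := hgS n x hn
        rw [h0]; simp only [birkhoffSum_zero, sub_zero]
        have : 0 ≤ c * n := by positivity
        linarith

theorem kingman_upper {α : Type*} [MeasurableSpace α] {μ : Measure α} [IsProbabilityMeasure μ]
    {T : α → α} (hT : Ergodic T μ) {g : ℕ → α → ℝ} (hgm : ∀ n, Measurable (g n))
    (hnn : ∀ n x, 0 ≤ g n x) (hint : Integrable (g 1) μ)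
    (hsub : ∀ m n x, g (m + n) x ≤ g m x + g n (T^[m] x)) {c : ℝ} (hc : 0 ≤ c)
    (hfull : ∀ᵐ x ∂μ, ∃ k : ℕ, 1 ≤ k ∧ g k x ≤ c * k) {ε : ℝ} (hε : 0 < ε) :
    ∀ᵐ x ∂μ, ∀ᶠ n : ℕ in atTop, g n x ≤ (c + ε) * n := by
  set B : ℕ → Set α := fun L => {x | ∀ k, 1 ≤ k → k ≤ L → c * k < g k x} with hBdef
  have hBm : ∀ L, MeasurableSet (B L) := by
    intro L
    simp only [hBdef, Set.ofPred_forall]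
    exact MeasurableSet.iInter fun k => MeasurableSet.iInter fun _ => MeasurableSet.iInter fun _ =>
      measurableSet_lt measurable_const (hgm k)
  have hlim : Tendsto (fun L => ∫ x, (B L).indicator (g 1) x ∂μ) atTop (𝓝 (∫ x, (0:ℝ) ∂μ)) := by
    refine tendsto_integral_of_dominated_convergence (g 1) ?_ hint ?_ ?_
    · intro n; exact ((hgm 1).indicator (hBm n)).aestronglyMeasurable
    · intro n; refine ae_of_all _ fun x => ?_
      rw [Real.norm_eq_abs, abs_of_nonneg (Set.indicator_nonneg (fun x _ => hnn 1 x) x)]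
      exact Set.indicator_le_self' (fun x _ => hnn 1 x) x
    · filter_upwards [hfull] with x ⟨k, hk1, hk⟩
      refine tendsto_const_nhds.congr' ?_
      filter_upwards [eventually_ge_atTop k] with L hL
      rw [Set.indicator_of_notMem]
      intro hx
      exact absurd (hx k hk1 hL) (not_lt.2 hk)
  rw [integral_zero] at hlim
  obtain ⟨L, hL⟩ := (hlim.eventually (gt_mem_nhds (show (0:ℝ) < ε / 2 by positivity))).exists
  have hb1 := birkhoff_upper hT ((hgm 1).indicator (hBm L)) (hint.indicator (hBm L)) hL
  have hb2 := birkhoff_tendsto hT (hgm 1) hint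
  filter_upwards [hb1, hb2] with x hx1 hx2
  have hgr := kingman_greedy hnn hsub hc L (B L) (fun x hx => by
    simp only [hBdef, Set.mem_ofPred_eq] at hx; push Not at hx
    exact hx)
  have h3 := hx2 (ε / 8) (by positivity)
  have h4 : ∀ᶠ n : ℕ in atTop, |birkhoffSum T (g 1) (n - L) x - (n - L : ℕ) * ∫ x, g 1 x ∂μ|
      ≤ (n - L : ℕ) * (ε / 8) := (tendsto_sub_atTop_nat L).eventually h3
  have h5 : ∀ᶠ n : ℕ in atTop, (L : ℝ) * (∫ x, g 1 x ∂μ) ≤ n * (ε / 8) :=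
    (tendsto_natCast_atTop_atTop.atTop_mul_const (by positivity)).eventually_ge_atTop _
  filter_upwards [hx1, h3, h4, h5, eventually_ge_atTop (L + 1)] with n k1 k2 k3 k4 k5
  have := hgr n x (by omega)
  have e : ((n - L : ℕ) : ℝ) = n - L := by rw [Nat.cast_sub (by omega)]
  rw [e] at k3
  rw [abs_le] at k2 k3
  have : (0:ℝ) ≤ L * (ε / 8) := by positivity
  nlinarith

theorem kingman {α : Type*} [MeasurableSpace α] {μ : Measure α} [IsProbabilityMeasure μ]
    {T : α → α} (hT : Ergodic T μ) {g : ℕ → α → ℝ} (hgm : ∀ n, Measurable (g n))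
    (hnn : ∀ n x, 0 ≤ g n x) (hint : Integrable (g 1) μ)
    (hsub : ∀ m n x, g (m + n) x ≤ g m x + g n (T^[m] x)) :
    ∃ γ : ℝ, ∀ᵐ x ∂μ, Tendsto (fun n : ℕ => g n x / n) atTop (𝓝 γ) := by
  -- L c = {liminf < c}
  set Lo : ℝ → Set α := fun c => {x | ∃ q : ℚ, (q : ℝ) < c ∧ ∃ᶠ n : ℕ in atTop, g n x < q * n}
    with hLo
  have hLm : ∀ c, MeasurableSet (Lo c) := by
    intro c
    have : Lo c = ⋃ q : ℚ, ⋃ _ : (q : ℝ) < c, ⋂ N : ℕ, ⋃ n : ℕ, ⋃ _ : N ≤ n,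
        {x | g n x < q * n} := by
      ext x
      simp [hLo, frequently_atTop]
    rw [this]
    exact MeasurableSet.iUnion fun q => MeasurableSet.iUnion fun _ => MeasurableSet.iInter fun N =>
      MeasurableSet.iUnion fun n => MeasurableSet.iUnion fun _ =>
        measurableSet_lt (hgm n) measurable_const
  have hLinv : ∀ c, T ⁻¹' (Lo c) ⊆ Lo c := by
    rintro c x ⟨q, hq, hf⟩
    obtain ⟨r, hr1, hr2⟩ := exists_rat_btwn hq
    refine ⟨r, hr2, ?_⟩
    have hev : ∀ᶠ n : ℕ in atTop, g 1 x - r ≤ n * ((r : ℝ) - q) :=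
      (tendsto_natCast_atTop_atTop.atTop_mul_const (by linarith)).eventually_ge_atTop _
    have h3 : ∃ᶠ n : ℕ in atTop, g (n + 1) x < r * (n + 1 : ℕ) := by
      refine (hf.and_eventually hev).mono ?_
      rintro n ⟨h1, h2⟩
      have := hsub 1 n x
      rw [add_comm 1 n] at this
      simp only [Function.iterate_one] at this
      push_cast; linarith
    exact (tendsto_add_atTop_nat 1).frequently h3
  have hdich : ∀ c, (∀ᵐ x ∂μ, x ∈ Lo c) ∨ (∀ᵐ x ∂μ, x ∉ Lo c) := by
    intro c
    have := hT.ae_empty_or_univ_of_preimage_ae_le (hLm c).nullMeasurableSet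
      (LE.le.eventuallyLE (hLinv c))
    rcases this with h | h
    · right; filter_upwards [h.mem_iff] with x hx; rw [hx]; simp
    · left; filter_upwards [h.mem_iff] with x hx; rw [hx]; simp
  have hmono : ∀ c d, c ≤ d → Lo c ⊆ Lo d := fun c d hcd x ⟨q, hq, h⟩ => ⟨q, hq.trans_le hcd, h⟩
  set S : Set ℝ := {c | ∀ᵐ x ∂μ, x ∈ Lo c} with hS
  have hSb : ∀ c ∈ S, 0 ≤ c := by
    intro c hcS
    obtain ⟨x, q, hq, hf⟩ := Eventually.exists (f := ae μ) (p := fun x => x ∈ Lo c) hcS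
    by_contra! hneg
    obtain ⟨n, hn⟩ := hf.exists
    have := hnn n x
    have hn0 : (0 : ℝ) ≤ n := Nat.cast_nonneg n
    nlinarith
  have hup : ∀ c ∈ S, ∀ ε > 0, ∀ᵐ x ∂μ, ∀ᶠ n : ℕ in atTop, g n x ≤ (c + ε) * n := by
    intro c hcS ε hε
    refine kingman_upper hT hgm hnn hint hsub (hSb c hcS) ?_ hε
    filter_upwards [hcS] with x ⟨q, hq, hf⟩
    obtain ⟨n, hn, hn1⟩ := (hf.and_eventually (eventually_ge_atTop 1)).exists
    refine ⟨n, hn1, hn.le.trans ?_⟩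
    gcongr
  have hSne : S.Nonempty := by
    set I := ∫ x, g 1 x ∂μ with hI
    have h1 := kingman_upper hT hgm hnn hint hsub (c := 0) le_rfl
    refine ⟨I + 3, ?_⟩
    have hb := birkhoff_upper hT (hgm 1) hint (show I < I + 1 by linarith)
    filter_upwards [hb] with x hx
    obtain ⟨q, hq1, hq2⟩ := exists_rat_btwn (show I + 1 < I + 3 by linarith)
    refine ⟨q, hq2, Eventually.frequently ?_⟩
    filter_upwards [hx, eventually_ge_atTop 1] with n hn hn1
    have hgr := kingman_greedy hnn hsub (c := 0) le_rfl n Set.univ (fun x hx => by simp at hx) n x hn1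
    simp only [Set.indicator_univ, Nat.sub_self, birkhoffSum_zero] at hgr
    have hgS : ∀ n x, 1 ≤ n → g n x ≤ birkhoffSum T (g 1) n x := by
      intro n
      induction n with
      | zero => intro x h; omega
      | succ n ih =>
        intro x _
        rcases Nat.eq_zero_or_pos n with h0 | h0
        · subst h0; simp
        · rw [birkhoffSum_succ', add_comm n 1]
          refine (hsub 1 n x).trans ?_
          simpa using ih (T x) h0
    have hn0 : (1:ℝ) ≤ n := by exact_mod_cast hn1
    have := hgS n x hn1
    nlinarith
  have hbdd : BddBelow S := ⟨0, fun c hc => hSb c hc⟩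
  refine ⟨sInf S, ?_⟩
  have hA : ∀ᵐ x ∂μ, ∀ k : ℕ, ∀ᶠ n : ℕ in atTop, g n x ≤ (sInf S + 2 * (1 / ((k:ℝ) + 1))) * n := by
    rw [ae_all_iff]; intro k
    have hk : 0 < 1 / ((k:ℝ) + 1) := by positivity
    obtain ⟨c, hcS, hc⟩ := exists_lt_of_csInf_lt hSne (show sInf S < sInf S + 1 / ((k:ℝ) + 1) by linarith)
    filter_upwards [hup c hcS _ hk] with x hx
    filter_upwards [hx] with n hn
    refine hn.trans (mul_le_mul_of_nonneg_right ?_ (Nat.cast_nonneg n))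
    linarith
  have hB : ∀ᵐ x ∂μ, ∀ k : ℕ, ∀ᶠ n : ℕ in atTop, (sInf S - 2 * (1 / ((k:ℝ) + 1))) * n ≤ g n x := by
    rw [ae_all_iff]; intro k
    have hk : 0 < 1 / ((k:ℝ) + 1) := by positivity
    have hnot : sInf S - 1 / ((k:ℝ) + 1) ∉ S := fun h => by
      have := csInf_le hbdd h; linarith
    filter_upwards [(hdich _).resolve_left hnot] with x hx
    simp only [hLo, Set.mem_ofPred_eq, not_exists, not_and, not_frequently, not_lt] at hx
    obtain ⟨q, hq1, hq2⟩ := exists_rat_btwn (show sInf S - 2 * (1 / ((k:ℝ) + 1)) < sInf S - 1 / ((k:ℝ) + 1) by linarith)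
    filter_upwards [hx q hq2] with n hn
    refine le_trans ?_ hn
    gcongr
  filter_upwards [hA, hB] with x hx1 hx2
  rw [Metric.tendsto_nhds]
  intro ε hε
  obtain ⟨k, hk⟩ := exists_nat_one_div_lt (show 0 < ε / 2 by positivity)
  filter_upwards [hx1 k, hx2 k, eventually_ge_atTop 1] with n h1 h2 hn
  have hn0 : (0:ℝ) < n := by exact_mod_cast hn
  rw [Real.dist_eq, abs_lt]
  constructor
  · rw [lt_sub_iff_add_lt, lt_div_iff₀ hn0]; nlinarith
  · rw [sub_lt_iff_lt_add, div_lt_iff₀ hn0]; nlinarith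

end ErgodicPart

section DetPart
open Topology

lemma proj_step {E ι : Type*} [NormedAddCommGroup E] [InnerProductSpace ℝ E] [Fintype ι]
    (b b' : OrthonormalBasis ι ℝ E) (J : ι → Prop) [DecidablePred J] {δ : ℝ} (hδ0 : 0 ≤ δ)
    (hδ : δ ≤ 1 / 2)
    (h : ∀ w : E, (∀ i, ¬ J i → inner ℝ (b i) w = 0) →
      ∑ l with ¬ J l, |inner ℝ (b' l) w| ≤ δ * ‖w‖)
    (v : E) (hv : ∀ i, ¬ J i → inner ℝ (b' i) v = 0) :
    ∃ w : E, (∀ i, ¬ J i → inner ℝ (b i) w = 0) ∧ ‖w‖ ≤ (1 + 2 * δ) * ‖v‖ ∧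
      v = w - ∑ l with ¬ J l, (inner ℝ (b' l) w : ℝ) • b' l := by
  classical
  have hnorm : ∀ w : E, ‖∑ l with ¬ J l, (inner ℝ (b' l) w : ℝ) • b' l‖ ≤
      ∑ l with ¬ J l, |inner ℝ (b' l) w| := by
    intro w
    refine (norm_sum_le _ _).trans (Finset.sum_le_sum fun l _ => ?_)
    rw [norm_smul, b'.norm_eq_one, mul_one, Real.norm_eq_abs]
  have hsplit : ∀ w : E, w = ∑ l with J l, (inner ℝ (b' l) w : ℝ) • b' l
      + ∑ l with ¬ J l, (inner ℝ (b' l) w : ℝ) • b' l := by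
    intro w
    rw [Finset.sum_filter_add_sum_filter_not]
    exact (b'.sum_repr' w).symm
  let S : ({i // J i} → ℝ) →ₗ[ℝ] E := Fintype.linearCombination ℝ (fun j : {i // J i} => b j.1)
  have hS : ∀ c, S c = ∑ j, c j • b j.1 := fun c => by
    simp [S, Fintype.linearCombination_apply]
  let R : E →ₗ[ℝ] ({i // J i} → ℝ) := LinearMap.pi fun j => (innerₛₗ ℝ (b' j.1))
  have hR : ∀ w j, R w j = inner ℝ (b' j.1) w := fun w j => by simp [R]
  have hSV : ∀ c i, ¬ J i → inner ℝ (b i) (S c) = 0 := by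
    intro c i hi
    rw [hS, inner_sum]
    refine Finset.sum_eq_zero fun j _ => ?_
    rw [inner_smul_right, b.inner_eq_ite]
    have : i ≠ j.1 := fun h => hi (h ▸ j.2)
    simp [this]
  have hSc : ∀ c j, inner ℝ (b j.1) (S c) = c j := by
    intro c j
    rw [hS, inner_sum, Finset.sum_eq_single j]
    · rw [inner_smul_right, b.inner_eq_ite]; simp
    · intro k _ hk
      rw [inner_smul_right, b.inner_eq_ite]
      have : j.1 ≠ k.1 := fun h => hk (Subtype.ext h.symm)
      simp [this]
    · simp
  have hinj : Function.Injective (R ∘ₗ S) := by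
    rw [injective_iff_map_eq_zero]
    intro c hc
    have h0 : ∑ l with J l, (inner ℝ (b' l) (S c) : ℝ) • b' l = 0 := by
      refine Finset.sum_eq_zero fun l hl => ?_
      have hJ : J l := (Finset.mem_filter.1 hl).2
      have := congrFun hc ⟨l, hJ⟩
      simp only [LinearMap.comp_apply, hR, Pi.zero_apply] at this
      rw [this, zero_smul]
    have h1 : ‖S c‖ ≤ δ * ‖S c‖ := by
      have h2 := hsplit (S c)
      rw [h0, zero_add] at h2
      calc ‖S c‖ = ‖∑ l with ¬ J l, (inner ℝ (b' l) (S c) : ℝ) • b' l‖ := by rw [← h2]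
        _ ≤ _ := (hnorm _).trans (h _ (hSV c))
    have h3 : ‖S c‖ = 0 := by nlinarith [norm_nonneg (S c)]
    ext j
    rw [← hSc c j, norm_eq_zero.1 h3]; simp
  have hsurj := LinearMap.injective_iff_surjective.1 hinj
  obtain ⟨c, hc⟩ := hsurj (R v)
  have hveq : v = S c - ∑ l with ¬ J l, (inner ℝ (b' l) (S c) : ℝ) • b' l := by
    have e1 := hsplit v
    have e2 := hsplit (S c)
    have e3 : ∑ l with ¬ J l, (inner ℝ (b' l) v : ℝ) • b' l = 0 := by
      refine Finset.sum_eq_zero fun l hl => ?_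
      rw [hv l (Finset.mem_filter.1 hl).2, zero_smul]
    have e4 : ∑ l with J l, (inner ℝ (b' l) v : ℝ) • b' l =
        ∑ l with J l, (inner ℝ (b' l) (S c) : ℝ) • b' l := by
      refine Finset.sum_congr rfl fun l hl => ?_
      have hJ : J l := (Finset.mem_filter.1 hl).2
      have := congrFun hc ⟨l, hJ⟩
      simp only [LinearMap.comp_apply, hR] at this
      rw [this]
    rw [e3, add_zero, e4] at e1
    rw [eq_sub_iff_add_eq]
    nth_rewrite 1 [e1]
    exact e2.symm
  refine ⟨S c, hSV c, ?_, hveq⟩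
  have h1 : ‖S c‖ ≤ ‖v‖ + δ * ‖S c‖ := by
    have : S c = v + ∑ l with ¬ J l, (inner ℝ (b' l) (S c) : ℝ) • b' l := by
      exact sub_eq_iff_eq_add.1 hveq.symm
    calc ‖S c‖ = ‖v + ∑ l with ¬ J l, (inner ℝ (b' l) (S c) : ℝ) • b' l‖ := by rw [← this]
      _ ≤ _ := (norm_add_le _ _).trans (by linarith [(hnorm (S c)).trans (h _ (hSV c))])
  have hv0 := norm_nonneg v
  have h2 : (1 - δ) * ‖S c‖ ≤ ‖v‖ := by linarith
  have h3 : ‖v‖ ≤ (1 - δ) * ((1 + 2 * δ) * ‖v‖) := by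
    have : 0 ≤ (δ - 2 * δ ^ 2) * ‖v‖ := mul_nonneg (by nlinarith) hv0
    nlinarith
  exact le_of_mul_le_mul_left (h2.trans h3) (by linarith)

lemma slow_bound {E ι : Type*} [NormedAddCommGroup E] [InnerProductSpace ℝ E] [Fintype ι]
    (b : ℕ → OrthonormalBasis ι ℝ E) (s : ℕ → ι → ℝ) (hs0 : ∀ n i, 0 ≤ s n i)
    (B : ℕ → E →L[ℝ] E)
    (hB : ∀ n v, ‖B n v‖ ^ 2 = ∑ i, (s n i) ^ 2 * (inner ℝ (b n i) v) ^ 2)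
    (a : ℕ → ℝ) (ha : ∀ n v, ‖B (n + 1) v‖ ≤ a n * ‖B n v‖)
    (hat : ∀ ε > 0, ∀ᶠ n : ℕ in atTop, a n ≤ Real.exp (n * ε))
    (χ : ι → ℝ)
    (hup : ∀ i, ∀ ε > 0, ∀ᶠ n : ℕ in atTop, s n i ≤ Real.exp (n * (χ i + ε)))
    (hlo : ∀ i, 0 < χ i → ∀ ε > 0, ∀ᶠ n : ℕ in atTop, Real.exp (n * (χ i - ε)) ≤ s n i) :
    ∀ (N : ℕ) (τ : ℝ), 0 ≤ τ → Fintype.card {i // τ < χ i} = N → ∀ ε > 0, ∀ᶠ n : ℕ in atTop,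
      ∀ m ≥ n, ∀ v : E, (∀ i, τ < χ i → inner ℝ (b m i) v = 0) →
        ‖B n v‖ ≤ Real.exp (n * (τ + ε)) * ‖v‖ := by
  classical
  intro N
  induction N using Nat.strong_induction_on with
  | _ N ih =>
  intro τ hτ hN ε hε
  obtain ⟨γ, hγ0, hγ⟩ : ∃ γ > 0, ∀ l, τ < χ l → γ ≤ χ l - τ := by
    have : ∃ γ > 0, ∀ l ∈ (Finset.univ.filter fun l => τ < χ l), γ ≤ χ l - τ := by
      rcases (Finset.univ.filter fun l => τ < χ l).eq_empty_or_nonempty with h | h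
      · exact ⟨1, one_pos, by simp [h]⟩
      · obtain ⟨l, hl, hmin⟩ := Finset.exists_min_image _ (fun l => χ l - τ) h
        exact ⟨χ l - τ, by have := (Finset.mem_filter.1 hl).2; linarith, hmin⟩
    obtain ⟨γ, h0, h1⟩ := this
    exact ⟨γ, h0, fun l hl => h1 l (by simp [hl])⟩
  set η := min (ε / 8) (γ / 8) with hη
  have hη0 : 0 < η := by positivity
  have hηε : η ≤ ε / 8 := min_le_left _ _
  have hηγ : η ≤ γ / 8 := min_le_right _ _
  set M : ℝ := ((Fintype.card ι : ℕ) : ℝ) with hM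
  have hM0 : 0 ≤ M := Nat.cast_nonneg _
  have hcardM : ∀ (P : ι → Prop) [DecidablePred P], ((Finset.univ.filter P).card : ℝ) ≤ M := by
    intro P _
    rw [hM]; exact_mod_cast Finset.card_le_univ _
  -- events
  have e1 := hat η hη0
  have e2 : ∀ᶠ n : ℕ in atTop, ∀ i, s n i ≤ Real.exp (n * (χ i + η)) :=
    eventually_all.2 fun i => hup i η hη0
  have e3 : ∀ᶠ n : ℕ in atTop, ∀ i, τ < χ i → Real.exp (n * (χ i - η)) ≤ s n i := by
    refine eventually_all.2 fun i => ?_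
    by_cases h : τ < χ i
    · filter_upwards [hlo i (by linarith) η hη0] with n hn _ using hn
    · exact Eventually.of_forall fun n h' => absurd h' h
  have e4 : ∀ᶠ n : ℕ in atTop, ∀ l, τ < χ l → ∀ m ≥ n, ∀ v : E,
      (∀ i, χ l < χ i → inner ℝ (b m i) v = 0) → ‖B n v‖ ≤ Real.exp (n * (χ l + η)) * ‖v‖ := by
    refine eventually_all.2 fun l => ?_
    by_cases h : τ < χ l
    · have hlt : Fintype.card {i // χ l < χ i} < N := by
        rw [← hN]
        rw [Fintype.card_subtype, Fintype.card_subtype]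
        apply Finset.card_lt_card
        rw [Finset.ssubset_iff_of_subset]
        · exact ⟨l, by simp [h], by simp⟩
        · intro i hi
          simp only [Finset.mem_filter, Finset.mem_univ, true_and] at hi ⊢
          linarith
      filter_upwards [ih _ hlt (χ l) (by linarith) rfl η hη0] with n hn _ using hn
    · exact Eventually.of_forall fun n h' => absurd h' h
  have hexp0 : Tendsto (fun n : ℕ => M * Real.exp (-(n * (γ / 2)))) atTop (𝓝 0) := by
    have h1 : Tendsto (fun n : ℕ => Real.exp (-((n : ℝ) * (γ / 2)))) atTop (𝓝 0) :=
      Real.tendsto_exp_neg_atTop_nhds_zero.comp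
        (tendsto_natCast_atTop_atTop.atTop_mul_const (by positivity))
    simpa using h1.const_mul M
  have e5 : ∀ᶠ n : ℕ in atTop, M * Real.exp (-(n * (γ / 2))) ≤ 1 / 2 :=
    (hexp0.eventually (gt_mem_nhds (show (0:ℝ) < 1 / 2 by norm_num))).mono fun n hn => hn.le
  set ρ := Real.exp (-(γ / 2)) with hρ
  have hρ0 : 0 ≤ ρ := (Real.exp_pos _).le
  have hρ1 : ρ < 1 := by rw [hρ, Real.exp_lt_one_iff]; linarith
  set D := 2 * M * (1 - ρ)⁻¹ with hD
  have e6 : ∀ᶠ n : ℕ in atTop, Real.exp D * 2 ≤ Real.exp (n * (ε / 2)) := by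
    have : Tendsto (fun n : ℕ => Real.exp ((n : ℝ) * (ε / 2))) atTop atTop :=
      Real.tendsto_exp_atTop.comp (tendsto_natCast_atTop_atTop.atTop_mul_const (by positivity))
    exact this.eventually_ge_atTop _
  obtain ⟨n0, hn0⟩ := eventually_atTop.1 (e1.and (e2.and (e3.and (e4.and (e5.and e6)))))
  filter_upwards [eventually_ge_atTop n0] with n hn
  -- Parseval
  have hpars : ∀ m (w : E), ∑ i, (inner ℝ (b m i) w) ^ 2 = ‖w‖ ^ 2 := by
    intro m w
    have := (b m).sum_sq_norm_inner_right w
    simpa using this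
  -- Fact A
  have factA : ∀ m ≥ n0, ∀ w : E, (∀ i, τ < χ i → inner ℝ (b m i) w = 0) →
      ‖B m w‖ ≤ Real.exp (m * (τ + η)) * ‖w‖ := by
    intro m hm w hw
    have h2 := (hn0 m hm).2.1
    refine le_of_sq_le_sq ?_ (by positivity)
    rw [hB, mul_pow, ← hpars m w, Finset.mul_sum]
    refine Finset.sum_le_sum fun i _ => ?_
    by_cases hi : τ < χ i
    · rw [hw i hi]; simp
    · refine mul_le_mul_of_nonneg_right ?_ (sq_nonneg _)
      refine pow_le_pow_left₀ (hs0 m i) ((h2 i).trans ?_) 2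
      apply Real.exp_le_exp.2
      push Not at hi
      gcongr
  -- Fact B
  have factB : ∀ m ≥ n0, ∀ w : E, (∀ i, τ < χ i → inner ℝ (b m i) w = 0) → ∀ l, τ < χ l →
      |inner ℝ (b (m + 1) l) w| ≤ Real.exp (-(m * (χ l - τ - 3 * η))) * ‖w‖ := by
    intro m hm w hw l hl
    have h1 := (hn0 m hm).1
    have h3 := (hn0 (m + 1) (by omega)).2.2.1 l hl
    have hγl := hγ l hl
    have k1 : s (m + 1) l * |inner ℝ (b (m + 1) l) w| ≤ ‖B (m + 1) w‖ := by
      refine le_of_sq_le_sq ?_ (norm_nonneg _)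
      rw [hB, mul_pow, sq_abs]
      exact Finset.single_le_sum (f := fun i => (s (m+1) i) ^ 2 * (inner ℝ (b (m+1) i) w) ^ 2)
        (fun i _ => by positivity) (Finset.mem_univ l)
    have k2 : ‖B (m + 1) w‖ ≤ Real.exp (m * (τ + 2 * η)) * ‖w‖ := by
      refine (ha m w).trans ?_
      calc a m * ‖B m w‖ ≤ Real.exp (m * η) * (Real.exp (m * (τ + η)) * ‖w‖) :=
            mul_le_mul h1 (factA m hm w hw) (norm_nonneg _) (Real.exp_pos _).le
        _ = Real.exp (m * (τ + 2 * η)) * ‖w‖ := by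
            rw [← mul_assoc, ← Real.exp_add]; ring_nf
    have k3 : Real.exp (m * (χ l - η)) ≤ s (m + 1) l := by
      refine le_trans (Real.exp_le_exp.2 ?_) h3
      push_cast
      have : 0 ≤ χ l - η := by linarith
      nlinarith
    have k4 : Real.exp (m * (χ l - η)) * |inner ℝ (b (m + 1) l) w| ≤
        Real.exp (m * (τ + 2 * η)) * ‖w‖ :=
      (mul_le_mul_of_nonneg_right k3 (abs_nonneg _)).trans (k1.trans k2)
    have k5 : Real.exp (m * (τ + 2 * η)) * ‖w‖ = Real.exp (m * (χ l - η)) *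
        (Real.exp (-(m * (χ l - τ - 3 * η))) * ‖w‖) := by
      rw [← mul_assoc, ← Real.exp_add]; ring_nf
    rw [k5] at k4
    exact le_of_mul_le_mul_left k4 (Real.exp_pos _)
  set Y := Real.exp (n * (τ + 4 * η)) with hY
  have hY0 : 0 < Y := Real.exp_pos _
  set d : ℕ → ℝ := fun r => 2 * M * ρ ^ r with hd
  have hd0 : ∀ r, 0 ≤ d r := fun r => by positivity
  have hρr : ∀ r : ℕ, ρ ^ r = Real.exp (-(r * (γ / 2))) := by
    intro r; rw [hρ, ← Real.exp_nat_mul]; ring_nf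
  have key : ∀ r : ℕ, ∀ v : E, (∀ i, τ < χ i → inner ℝ (b (n + r) i) v = 0) →
      ‖B n v‖ ≤ ((∏ j ∈ Finset.range r, (1 + d j)) * (2 * Y) - Y) * ‖v‖ := by
    intro r
    induction r with
    | zero =>
      intro v hv
      refine (factA n hn v hv).trans ?_
      simp only [Finset.range_zero, Finset.prod_empty, one_mul]
      refine mul_le_mul_of_nonneg_right ?_ (norm_nonneg _)
      have : Real.exp (n * (τ + η)) ≤ Y := by
        apply Real.exp_le_exp.2; gcongr; linarith
      linarith
    | succ r ihr =>
      intro v hv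
      set Z := (∏ j ∈ Finset.range r, (1 + d j)) * (2 * Y) - Y with hZ
      have hZ0 : 0 ≤ Z := by
        have : 1 ≤ ∏ j ∈ Finset.range r, (1 + d j) :=
          Finset.one_le_prod (fun j _ => by linarith [hd0 j])
        rw [hZ]; nlinarith
      have hm : n0 ≤ n + r := by omega
      set m := n + r with hmdef
      set δ := M * Real.exp (-(m * (γ / 2))) with hδ
      have hδhalf : δ ≤ 1 / 2 := (hn0 m hm).2.2.2.2.1
      have hδd : 2 * δ ≤ d r := by
        rw [hδ, hd]; simp only; rw [hρr, ← mul_assoc]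
        refine mul_le_mul_of_nonneg_left (Real.exp_le_exp.2 ?_) (by positivity)
        rw [hmdef]; push_cast
        have : 0 ≤ (n : ℝ) * (γ / 2) := by positivity
        linarith
      have hlsum : ∀ w : E, (∀ i, ¬ (χ i ≤ τ) → inner ℝ (b m i) w = 0) →
          ∑ l with ¬ (χ l ≤ τ), |inner ℝ (b (m + 1) l) w| ≤ δ * ‖w‖ := by
        intro w hw
        have : ∀ l ∈ Finset.univ.filter (fun l => ¬ (χ l ≤ τ)), |inner ℝ (b (m + 1) l) w| ≤
            Real.exp (-(m * (γ / 2))) * ‖w‖ := by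
          intro l hl
          have hl' : τ < χ l := by simpa using hl
          refine (factB m hm w (fun i hi => hw i (not_le.2 hi)) l hl').trans ?_
          refine mul_le_mul_of_nonneg_right (Real.exp_le_exp.2 ?_) (norm_nonneg _)
          have := hγ l hl'
          rw [neg_le_neg_iff]
          gcongr; linarith
        refine (Finset.sum_le_card_nsmul _ _ _ this).trans ?_
        rw [nsmul_eq_mul, hδ, mul_assoc]
        exact mul_le_mul_of_nonneg_right (hcardM _) (by positivity)
      obtain ⟨w, hw, hwn, hvw⟩ := proj_step (b m) (b (m + 1)) (fun i => χ i ≤ τ)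
        (by positivity) hδhalf hlsum v (fun i hi => hv i (not_le.1 hi))
      have hw' : ∀ i, τ < χ i → inner ℝ (b m i) w = 0 := fun i hi => hw i (not_le.2 hi)
      have hBw := ihr w hw'
      have hterm : ∀ l ∈ Finset.univ.filter (fun l => ¬ (χ l ≤ τ)),
          ‖B n ((inner ℝ (b (m + 1) l) w : ℝ) • b (m + 1) l)‖ ≤ ρ ^ r * Y * (2 * ‖v‖) := by
        intro l hl
        have hl' : τ < χ l := by simpa using hl
        rw [map_smul, norm_smul, Real.norm_eq_abs]
        have q1 := factB m hm w hw' l hl'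
        have q2 := (hn0 n hn).2.2.2.1 l hl' (m + 1) (by omega) (b (m + 1) l) (by
          intro i hi
          rw [(b (m+1)).inner_eq_ite]
          have : i ≠ l := fun h => by rw [h] at hi; exact lt_irrefl _ hi
          simp [this])
        rw [(b (m+1)).norm_eq_one, mul_one] at q2
        have q3 : ‖w‖ ≤ 2 * ‖v‖ := hwn.trans
          (mul_le_mul_of_nonneg_right (by linarith) (norm_nonneg _))
        calc |inner ℝ (b (m + 1) l) w| * ‖B n (b (m + 1) l)‖
            ≤ (Real.exp (-(m * (χ l - τ - 3 * η))) * ‖w‖) * Real.exp (n * (χ l + η)) :=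
              mul_le_mul q1 q2 (norm_nonneg _) (by positivity)
          _ = (Real.exp (-(m * (χ l - τ - 3 * η))) * Real.exp (n * (χ l + η))) * ‖w‖ := by ring
          _ ≤ (ρ ^ r * Y) * (2 * ‖v‖) := by
              refine mul_le_mul ?_ q3 (norm_nonneg _) (by positivity)
              rw [hρr, hY, ← Real.exp_add, ← Real.exp_add]
              apply Real.exp_le_exp.2
              rw [hmdef]; push_cast
              have := hγ l hl'
              have h5 : (r : ℝ) * (γ / 2) ≤ r * (χ l - τ - 3 * η) := by gcongr; linarith
              linarith
      have hBv : ‖B n v‖ ≤ ‖B n w‖ + M * (ρ ^ r * Y * (2 * ‖v‖)) := by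
        conv_lhs => rw [hvw]
        rw [map_sub, map_sum]
        refine (norm_sub_le _ _).trans ?_
        gcongr
        refine (norm_sum_le _ _).trans ?_
        refine (Finset.sum_le_card_nsmul _ _ _ hterm).trans ?_
        rw [nsmul_eq_mul]
        exact mul_le_mul_of_nonneg_right (hcardM _) (by positivity)
      rw [Finset.prod_range_succ]
      have hfin : (∏ j ∈ Finset.range r, (1 + d j)) * (1 + d r) * (2 * Y) - Y =
          (1 + d r) * Z + d r * Y := by rw [hZ]; ring
      rw [hfin]
      have hwn2 : ‖w‖ ≤ (1 + d r) * ‖v‖ := hwn.trans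
        (mul_le_mul_of_nonneg_right (by linarith) (norm_nonneg _))
      calc ‖B n v‖ ≤ Z * ‖w‖ + M * (ρ ^ r * Y * (2 * ‖v‖)) := by linarith
        _ ≤ Z * ((1 + d r) * ‖v‖) + M * (ρ ^ r * Y * (2 * ‖v‖)) := by gcongr
        _ = ((1 + d r) * Z + d r * Y) * ‖v‖ := by rw [hd]; ring
  have hprod : ∀ r, ∏ j ∈ Finset.range r, (1 + d j) ≤ Real.exp D := by
    intro r
    calc ∏ j ∈ Finset.range r, (1 + d j) ≤ ∏ j ∈ Finset.range r, Real.exp (d j) := by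
          refine Finset.prod_le_prod (fun j _ => by linarith [hd0 j]) fun j _ => ?_
          rw [add_comm]; exact Real.add_one_le_exp _
      _ = Real.exp (∑ j ∈ Finset.range r, d j) := (Real.exp_sum _ _).symm
      _ ≤ Real.exp D := by
          apply Real.exp_le_exp.2
          rw [hd, ← Finset.mul_sum, hD]
          refine mul_le_mul_of_nonneg_left ?_ (by positivity)
          rw [← tsum_geometric_of_lt_one hρ0 hρ1]
          exact (summable_geometric_of_lt_one hρ0 hρ1).sum_le_tsum _ (fun i _ => by positivity)
  intro m hm v hv
  obtain ⟨r, rfl⟩ := Nat.exists_eq_add_of_le hm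
  refine (key r v hv).trans (mul_le_mul_of_nonneg_right ?_ (norm_nonneg _))
  have h6 := (hn0 n hn).2.2.2.2.2
  calc (∏ j ∈ Finset.range r, (1 + d j)) * (2 * Y) - Y ≤ Real.exp D * (2 * Y) := by
        have := mul_le_mul_of_nonneg_right (hprod r) (show 0 ≤ 2 * Y by positivity)
        linarith
    _ = (Real.exp D * 2) * Y := by ring
    _ ≤ Real.exp (n * (ε / 2)) * Y := by gcongr
    _ ≤ Real.exp (n * (τ + ε)) := by
        rw [hY, ← Real.exp_add]
        apply Real.exp_le_exp.2
        have : (n : ℝ) * (4 * η) ≤ n * (ε / 2) := by gcongr; linarith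
        linarith

lemma uniform_growth {E ι : Type*} [NormedAddCommGroup E] [InnerProductSpace ℝ E] [Fintype ι]
    [FiniteDimensional ℝ E]
    (b : ℕ → OrthonormalBasis ι ℝ E) (s : ℕ → ι → ℝ) (hs0 : ∀ n i, 0 ≤ s n i)
    (B : ℕ → E →L[ℝ] E)
    (hB : ∀ n v, ‖B n v‖ ^ 2 = ∑ i, (s n i) ^ 2 * (inner ℝ (b n i) v) ^ 2)
    (a : ℕ → ℝ) (ha : ∀ n v, ‖B (n + 1) v‖ ≤ a n * ‖B n v‖)
    (hat : ∀ ε > 0, ∀ᶠ n : ℕ in atTop, a n ≤ Real.exp (n * ε))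
    (χ : ι → ℝ)
    (hup : ∀ i, ∀ ε > 0, ∀ᶠ n : ℕ in atTop, s n i ≤ Real.exp (n * (χ i + ε)))
    (hlo : ∀ i, 0 < χ i → ∀ ε > 0, ∀ᶠ n : ℕ in atTop, Real.exp (n * (χ i - ε)) ≤ s n i)
    (G : Submodule ℝ E)
    (hG : ∀ v ∈ G, (∀ ε > 0, ∀ᶠ n : ℕ in atTop, ‖B n v‖ ≤ Real.exp (n * ε) * ‖v‖) → v = 0) :
    ∃ lam > 0, ∃ c > 0, ∀ᶠ n : ℕ in atTop, ∀ v ∈ G, c * Real.exp (n * lam) * ‖v‖ ≤ ‖B n v‖ := by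
  classical
  have hslow := slow_bound b s hs0 B hB a ha hat χ hup hlo _ 0 le_rfl rfl
  set f : ℕ → E → ℝ := fun n v => ∑ l with 0 < χ l, |inner ℝ (b n l) v| with hf
  have hclaim : ∃ c > 0, ∀ᶠ n : ℕ in atTop, ∀ v ∈ G, c * ‖v‖ ≤ f n v := by
    by_contra! hcon
    have h1 : ∀ k : ℕ, ∃ n ≥ k, ∃ v ∈ G, ‖v‖ = 1 ∧ f n v < 1 / ((k : ℝ) + 1) := by
      intro k
      have := hcon (1 / ((k : ℝ) + 1)) (by positivity)
      obtain ⟨n, hnk, v, hvG, hv⟩ := frequently_atTop.1 this k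
      have hf0 : 0 ≤ f n v := Finset.sum_nonneg fun _ _ => abs_nonneg _
      have hv0 : 0 < ‖v‖ := by
        rcases (norm_nonneg v).eq_or_lt with h | h
        · rw [← h] at hv; linarith
        · exact h
      refine ⟨n, hnk, ‖v‖⁻¹ • v, G.smul_mem _ hvG, ?_, ?_⟩
      · rw [norm_smul, norm_inv, norm_norm, inv_mul_cancel₀ hv0.ne']
      · have : f n (‖v‖⁻¹ • v) = ‖v‖⁻¹ * f n v := by
          simp only [hf, Finset.mul_sum]
          refine Finset.sum_congr rfl fun l _ => ?_
          rw [inner_smul_right, abs_mul, abs_of_pos (inv_pos.2 hv0)]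
        rw [this, inv_mul_lt_iff₀ hv0]
        linarith
    choose nk hnk v hvG hv1 hvf using h1
    obtain ⟨v0, hv0, φ, hφ, hlim⟩ := (isCompact_sphere (0 : E) 1).tendsto_subseq
      (x := v) (fun k => by simp [hv1 k])
    have hv0n : ‖v0‖ = 1 := by simpa using hv0
    have hv0G : v0 ∈ G := by
      have hcl : IsClosed (G : Set E) := G.closed_of_finiteDimensional
      exact hcl.mem_of_tendsto hlim (Eventually.of_forall fun k => hvG _)
    set w : ℕ → E := fun k => v k - ∑ l with 0 < χ l, (inner ℝ (b (nk k) l) (v k) : ℝ) • b (nk k) l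
      with hw
    have hwv : Tendsto (fun k => w (φ k)) atTop (𝓝 v0) := by
      have hz : Tendsto (fun k => w k - v k) atTop (𝓝 0) := by
        refine squeeze_zero_norm (fun k => ?_) tendsto_one_div_add_atTop_nhds_zero_nat
        have : w k - v k = - ∑ l with 0 < χ l, (inner ℝ (b (nk k) l) (v k) : ℝ) • b (nk k) l := by
          rw [hw]; simp
        rw [this, norm_neg]
        refine le_trans ?_ (hvf k).le
        refine (norm_sum_le _ _).trans (Finset.sum_le_sum fun l _ => ?_)
        rw [norm_smul, (b (nk k)).norm_eq_one, mul_one, Real.norm_eq_abs]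
      have := (hz.comp hφ.tendsto_atTop).add hlim
      simpa using this
    have hwV : ∀ k i, 0 < χ i → inner ℝ (b (nk k) i) (w k) = 0 := by
      intro k i hi
      simp only [hw, inner_sub_right, inner_sum, inner_smul_right, (b (nk k)).inner_eq_ite]
      simp [hi]
    have : v0 = 0 := by
      refine hG v0 hv0G fun ε hε => ?_
      filter_upwards [hslow ε hε] with n hn
      rw [zero_add] at hn
      have t1 : Tendsto (fun k => ‖B n (w (φ k))‖) atTop (𝓝 ‖B n v0‖) :=
        ((B n).continuous.norm.tendsto v0).comp hwv
      have t2 : Tendsto (fun k => Real.exp (n * ε) * ‖w (φ k)‖) atTop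
          (𝓝 (Real.exp (n * ε) * ‖v0‖)) := hwv.norm.const_mul _
      refine le_of_tendsto_of_tendsto t1 t2 ?_
      filter_upwards [eventually_ge_atTop n] with k hk
      exact hn (nk (φ k)) (hk.trans ((hφ.id_le k).trans (hnk _))) _ (hwV _)
    rw [this] at hv0n; simp at hv0n
  obtain ⟨c, hc, hcl⟩ := hclaim
  obtain ⟨lam, hl0, hl⟩ : ∃ γ > 0, ∀ l, 0 < χ l → γ ≤ χ l / 2 := by
    have : ∃ γ > 0, ∀ l ∈ (Finset.univ.filter fun l => 0 < χ l), γ ≤ χ l / 2 := by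
      rcases (Finset.univ.filter fun l => 0 < χ l).eq_empty_or_nonempty with h | h
      · exact ⟨1, one_pos, by simp [h]⟩
      · obtain ⟨l, hl, hmin⟩ := Finset.exists_min_image _ (fun l => χ l / 2) h
        exact ⟨χ l / 2, by have := (Finset.mem_filter.1 hl).2; linarith, hmin⟩
    obtain ⟨γ, h0, h1⟩ := this
    exact ⟨γ, h0, fun l hl => h1 l (by simp [hl])⟩
  set M : ℝ := ((Fintype.card ι : ℕ) : ℝ) with hM
  have hM0 : 0 ≤ M := Nat.cast_nonneg _
  refine ⟨lam, hl0, c / (M + 1), by positivity, ?_⟩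
  have e3 : ∀ᶠ n : ℕ in atTop, ∀ i, 0 < χ i → Real.exp (n * lam) ≤ s n i := by
    refine eventually_all.2 fun i => ?_
    by_cases h : 0 < χ i
    · filter_upwards [hlo i h lam hl0] with n hn _
      refine le_trans (Real.exp_le_exp.2 ?_) hn
      have := hl i h
      gcongr; linarith
    · exact Eventually.of_forall fun n h' => absurd h' h
  filter_upwards [hcl, e3] with n h1 h2 v hv
  have k1 : ∀ l ∈ Finset.univ.filter (fun l => 0 < χ l),
      Real.exp (n * lam) * |inner ℝ (b n l) v| ≤ ‖B n v‖ := by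
    intro l hl
    have hl' : 0 < χ l := by simpa using hl
    refine (mul_le_mul_of_nonneg_right (h2 l hl') (abs_nonneg _)).trans ?_
    refine le_of_sq_le_sq ?_ (norm_nonneg _)
    rw [hB, mul_pow, sq_abs]
    exact Finset.single_le_sum (f := fun i => (s n i) ^ 2 * (inner ℝ (b n i) v) ^ 2)
      (fun i _ => by positivity) (Finset.mem_univ l)
  have k2 : Real.exp (n * lam) * f n v ≤ M * ‖B n v‖ := by
    rw [hf, Finset.mul_sum]
    refine (Finset.sum_le_card_nsmul _ _ _ k1).trans ?_
    rw [nsmul_eq_mul]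
    refine mul_le_mul_of_nonneg_right ?_ (norm_nonneg _)
    rw [hM]; exact_mod_cast Finset.card_le_univ _
  have k3 : Real.exp (n * lam) * (c * ‖v‖) ≤ Real.exp (n * lam) * f n v :=
    mul_le_mul_of_nonneg_left (h1 v hv) (Real.exp_pos _).le
  rw [div_mul_eq_mul_div, div_mul_eq_mul_div, div_le_iff₀ (by positivity)]
  nlinarith [norm_nonneg (B n v)]

end DetPart

section DetSub
open Topology Matrix

lemma psd_det_one_add_ge {n : Type*} [Fintype n] [DecidableEq n] {X : Matrix n n ℝ}
    (hX : X.PosSemidef) : 1 ≤ (1 + X).det := by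
  have h := hX.isHermitian
  have h1 : (1 + X).det = ∏ i, (1 + h.eigenvalues i) := by
    have := h.charpoly_eq
    have h2 : (1 + X).det = (-1) ^ Fintype.card n * (X.charpoly.eval (-1)) := by
      rw [Matrix.eval_charpoly, ← Matrix.det_neg]
      congr 1
      ext i j
      by_cases hij : i = j <;> simp [hij, Matrix.one_apply, Matrix.scalar_apply] <;> ring
    rw [h2, this, Polynomial.eval_prod]
    simp only [Polynomial.eval_sub, Polynomial.eval_X, Polynomial.eval_C]
    rw [← Finset.card_univ, ← Finset.prod_const, ← Finset.prod_mul_distrib]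
    refine Finset.prod_congr rfl fun i _ => ?_
    simp; ring
  rw [h1]
  exact Finset.one_le_prod fun i _ => by linarith [hX.eigenvalues_nonneg i]

lemma det_one_add_smul_eq {n : Type*} [Fintype n] [DecidableEq n] {X : Matrix n n ℝ}
    (h : X.IsHermitian) (t : ℝ) : (1 + t • X).det = ∏ i, (1 + t * h.eigenvalues i) := by
  by_cases ht : t = 0
  · simp [ht]
  have h2 : (1 + t • X).det = (-t) ^ Fintype.card n * (X.charpoly.eval (-t⁻¹)) := by
    rw [Matrix.eval_charpoly, ← Matrix.det_smul]
    congr 1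
    ext i j
    by_cases hij : i = j <;> simp [hij, Matrix.one_apply, Matrix.scalar_apply] <;> field_simp <;> ring
  rw [h2, h.charpoly_eq, Polynomial.eval_prod]
  simp only [Polynomial.eval_sub, Polynomial.eval_X, Polynomial.eval_C]
  rw [← Finset.card_univ, ← Finset.prod_const, ← Finset.prod_mul_distrib]
  refine Finset.prod_congr rfl fun i _ => ?_
  simp; field_simp; ring

lemma det_le_add {n m : Type*} [Fintype n] [DecidableEq n] [Fintype m] [DecidableEq m]
    {X : Matrix n n ℝ} (hX : X.PosDef) (W : Matrix m n ℝ) :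
    X.det ≤ (X + Wᵀ * W).det := by
  have hu : IsUnit X.det := hX.det_pos.ne'.isUnit
  have h1 : (X + Wᵀ * W).det = X.det * (1 + W * X⁻¹ * Wᵀ).det := by
    rw [Matrix.mul_assoc, Matrix.det_one_add_mul_comm, ← Matrix.det_mul, Matrix.mul_add,
      Matrix.mul_one, Matrix.mul_assoc, ← Matrix.mul_assoc X, Matrix.mul_nonsing_inv _ hu,
      Matrix.one_mul]
  have h2 : (W * X⁻¹ * Wᵀ).PosSemidef := by
    have := hX.inv.posSemidef.mul_mul_conjTranspose_same W
    simpa using this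
  rw [h1]
  exact le_mul_of_one_le_right hX.det_pos.le (psd_det_one_add_ge h2)

/-- the determinant `det (1 + Xᵀ X)` -/
noncomputable def gramDet {n : Type*} [Fintype n] [DecidableEq n] (X : Matrix n n ℝ) : ℝ :=
  (1 + Xᵀ * X).det

lemma gramDet_ge_one {n : Type*} [Fintype n] [DecidableEq n] (X : Matrix n n ℝ) :
    1 ≤ gramDet X := by
  have := Matrix.posSemidef_conjTranspose_mul_self X
  exact psd_det_one_add_ge (by simpa using this)

lemma gramDet_mul_le {n : Type*} [Fintype n] [DecidableEq n] (X Y : Matrix n n ℝ) :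
    gramDet (X * Y) ≤ gramDet X * gramDet Y := by
  have hR : (1 + Y * Yᵀ).PosDef := by
    have h1 := Matrix.posSemidef_self_mul_conjTranspose Y
    exact Matrix.PosDef.one.add_posSemidef (by simpa using h1)
  have hu : IsUnit (1 + Y * Yᵀ).det := hR.det_pos.ne'.isUnit
  -- step 1
  have s1 : gramDet (X * Y) = (1 + X * (Y * Yᵀ) * Xᵀ).det := by
    unfold gramDet
    rw [Matrix.det_one_add_mul_comm, Matrix.transpose_mul]
    simp only [Matrix.mul_assoc]
  have s2 : (1 + X * (Y * Yᵀ) * Xᵀ).det ≤ (1 + X * (1 + Y * Yᵀ) * Xᵀ).det := by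
    have hpd : (1 + X * (Y * Yᵀ) * Xᵀ).PosDef := by
      have h1 := (Matrix.posSemidef_self_mul_conjTranspose Y).mul_mul_conjTranspose_same X
      exact Matrix.PosDef.one.add_posSemidef (by simpa using h1)
    have := det_le_add hpd Xᵀ
    refine this.trans_eq ?_
    congr 1
    rw [Matrix.transpose_transpose, Matrix.mul_add, Matrix.mul_one, Matrix.add_mul]
    abel
  have s3 : (1 + X * (1 + Y * Yᵀ) * Xᵀ).det =
      (1 + Y * Yᵀ).det * ((1 + Y * Yᵀ)⁻¹ + Xᵀ * X).det := by
    rw [← Matrix.det_mul, Matrix.mul_add _ _ (Xᵀ * X), Matrix.mul_nonsing_inv _ hu, Matrix.mul_assoc,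
      Matrix.det_one_add_mul_comm, Matrix.mul_assoc]
  have s4 : ((1 + Y * Yᵀ)⁻¹ + Xᵀ * X).det ≤ (1 + Xᵀ * X).det := by
    -- det(1+XᵀX) = det((R⁻¹ + XᵀX) + (1 - R⁻¹))
    set R := 1 + Y * Yᵀ with hRd
    have hRi : R⁻¹.PosDef := hR.inv
    have hpd : (R⁻¹ + Xᵀ * X).PosDef := by
      have h1 := Matrix.posSemidef_conjTranspose_mul_self X
      exact hRi.add_posSemidef (by simpa using h1)
    have hs : (R⁻¹)ᵀ = R⁻¹ := by
      have := hRi.isHermitian.eq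
      simpa using this
    have e1 : R⁻¹ * (Y * Yᵀ) = 1 - R⁻¹ := by
      have : R⁻¹ * R = 1 := Matrix.nonsing_inv_mul _ hu
      rw [hRd, Matrix.mul_add, Matrix.mul_one, ← hRd] at this
      rw [← this]; abel
    have hpd2 : (R⁻¹ + Xᵀ * X + ((R⁻¹ * Y)ᵀ)ᵀ * (R⁻¹ * Y)ᵀ).PosDef := by
      have h1 := Matrix.posSemidef_conjTranspose_mul_self (R⁻¹ * Y)ᵀ
      exact hpd.add_posSemidef (by simpa using h1)
    have f1 := det_le_add hpd (R⁻¹ * Y)ᵀ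
    have f2 := det_le_add hpd2 (R⁻¹ * (Y * Yᵀ))ᵀ
    refine (f1.trans f2).trans_eq ?_
    congr 1
    have e2 : ((R⁻¹ * Y)ᵀ)ᵀ * (R⁻¹ * Y)ᵀ = (1 - R⁻¹) * R⁻¹ := by
      rw [← e1, Matrix.transpose_transpose, Matrix.transpose_mul, hs]
      simp only [Matrix.mul_assoc]
    rw [e2, Matrix.transpose_transpose, e1, Matrix.transpose_sub, hs, Matrix.transpose_one]
    noncomm_ring
  rw [s1]
  refine s2.trans (s3.trans_le ?_)
  have hY : (1 + Y * Yᵀ).det = gramDet Y := by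
    unfold gramDet; rw [Matrix.det_one_add_mul_comm]
  rw [hY, mul_comm]
  exact mul_le_mul_of_nonneg_right s4 (by linarith [gramDet_ge_one Y])

end DetSub

section ConvPart
open Topology

lemma mapCluster_eq {X : Type*} [TopologicalSpace X] [T2Space X] {u : ℕ → X} {z γ : X}
    (hz : MapClusterPt z atTop u) (h : Tendsto u atTop (𝓝 γ)) : z = γ := by
  have h1 : ClusterPt z (𝓝 γ) := ClusterPt.mono hz h
  have : NeBot (𝓝 z ⊓ 𝓝 γ) := h1
  exact eq_of_nhds_neBot this

lemma trunc_inj {d : ℕ} {z z' : Fin d → ℝ} (hz0 : ∀ i, 0 ≤ z i) (hz0' : ∀ i, 0 ≤ z' i)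
    (hz : Antitone z) (hz' : Antitone z')
    (h : ∀ t : ℚ, 0 ≤ t → ∑ i, max (z i - t) 0 = ∑ i, max (z' i - t) 0) : z = z' := by
  have key : ∀ (z z' : Fin d → ℝ), (∀ i, 0 ≤ z i) → (∀ i, 0 ≤ z' i) → Antitone z → Antitone z' →
    (∀ t : ℚ, 0 ≤ t → ∑ i, max (z i - t) 0 = ∑ i, max (z' i - t) 0) → ∀ i,
    (∀ j < i, z j = z' j) → z i ≤ z' i := by
    intro z z' hz0 hz0' hz hz' h i hi
    by_contra hlt
    push Not at hlt
    obtain ⟨t, ht1, ht2⟩ := exists_rat_btwn hlt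
    have ht0 : (0 : ℚ) ≤ t := by exact_mod_cast (hz0' i).trans ht1.le
    have := h t ht0
    have h2 : ∑ j, max (z' j - t) 0 < ∑ j, max (z j - t) 0 := by
      refine Finset.sum_lt_sum (fun j _ => ?_) ⟨i, Finset.mem_univ _, ?_⟩
      · rcases lt_or_ge j i with hj | hj
        · rw [hi j hj]
        · have := hz' hj
          rw [max_eq_right (by linarith : z' j - t ≤ 0)]
          exact le_max_right _ _
      · rw [max_eq_right (by linarith : z' i - t ≤ 0)]
        exact lt_max_of_lt_left (by linarith)
    linarith
  funext i
  induction i using WellFoundedLT.induction with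
  | _ i ih =>
    refine le_antisymm (key z z' hz0 hz0' hz hz' h i ih)
      (key z' z hz0' hz0 hz' hz (fun t ht => (h t ht).symm) i (fun j hj => (ih j hj).symm))

lemma conv_of_trunc {d : ℕ} (y : ℕ → Fin d → ℝ) (hy0 : ∀ n i, 0 ≤ y n i)
    (hanti : ∀ n, Antitone (y n))
    (h : ∀ t : ℚ, 0 ≤ t → ∃ γ, Tendsto (fun n => ∑ i, max (y n i - t) 0) atTop (𝓝 γ)) :
    ∃ χ : Fin d → ℝ, ∀ i, Tendsto (fun n => y n i) atTop (𝓝 (χ i)) := by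
  choose! γ hγ using h
  set K : Set (Fin d → ℝ) := Set.pi Set.univ fun _ => Set.Icc 0 (γ 0 + 1) with hK
  have hKc : IsCompact K := isCompact_univ_pi fun _ => isCompact_Icc
  have hmem : ∀ᶠ n in atTop, y n ∈ K := by
    have h1 : ∀ᶠ n in atTop, ∑ i, max (y n i - (0:ℚ)) 0 < γ 0 + 1 :=
      (hγ 0 le_rfl).eventually (gt_mem_nhds (by linarith))
    filter_upwards [h1] with n hn i _
    refine ⟨hy0 n i, le_trans ?_ hn.le⟩
    refine le_trans ?_ (Finset.single_le_sum (f := fun i => max (y n i - (0:ℚ)) 0)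
      (fun j _ => le_max_right _ _) (Finset.mem_univ i))
    simp
  have hcl : ∀ z, MapClusterPt z atTop y → (∀ i, 0 ≤ z i) ∧ Antitone z ∧
      ∀ t : ℚ, 0 ≤ t → ∑ i, max (z i - t) 0 = γ t := by
    intro z hz
    have hC : IsClosed {w : Fin d → ℝ | (∀ i, 0 ≤ w i) ∧ ∀ i j, i ≤ j → w j ≤ w i} := by
      have : {w : Fin d → ℝ | (∀ i, 0 ≤ w i) ∧ ∀ i j, i ≤ j → w j ≤ w i} =
        (⋂ i, {w : Fin d → ℝ | 0 ≤ w i}) ∩ ⋂ i, ⋂ j, ⋂ (_ : i ≤ j), {w | w j ≤ w i} := by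
        ext w; simp
      rw [this]
      refine IsClosed.inter (isClosed_iInter fun i => isClosed_le continuous_const
        (continuous_apply i)) (isClosed_iInter fun i => isClosed_iInter fun j =>
        isClosed_iInter fun _ => isClosed_le (continuous_apply j) (continuous_apply i))
    have hzC : z ∈ {w : Fin d → ℝ | (∀ i, 0 ≤ w i) ∧ ∀ i j, i ≤ j → w j ≤ w i} := by
      have hle : map y atTop ≤ 𝓟 {w : Fin d → ℝ | (∀ i, 0 ≤ w i) ∧ ∀ i j, i ≤ j → w j ≤ w i} := by
        rw [le_principal_iff, mem_map]
        exact Filter.Eventually.of_forall fun n => ⟨hy0 n, fun i j hij => hanti n hij⟩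
      have := ClusterPt.mono hz hle
      exact isClosed_iff_clusterPt.1 hC z this
    refine ⟨hzC.1, fun i j hij => hzC.2 i j hij, fun t ht => ?_⟩
    have hcont : Continuous fun w : Fin d → ℝ => ∑ i, max (w i - (t:ℝ)) 0 := by fun_prop
    exact mapCluster_eq (MapClusterPt.continuousAt_comp
      (f := fun w : Fin d → ℝ => ∑ i, max (w i - (t:ℝ)) 0) hcont.continuousAt hz) (hγ t ht)
  obtain ⟨z, hzK, hz⟩ := hKc.exists_mapClusterPt_of_frequently hmem.frequently
  refine ⟨z, ?_⟩
  rw [← tendsto_pi_nhds]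
  refine hKc.tendsto_nhds_of_unique_mapClusterPt hmem fun z' _ hz' => ?_
  obtain ⟨a1, a2, a3⟩ := hcl z hz
  obtain ⟨b1, b2, b3⟩ := hcl z' hz'
  exact trunc_inj b1 a1 b2 a2 fun t ht => by rw [a3 t ht, b3 t ht]

lemma log_trunc {L r t : ℝ} (hL : 0 ≤ L) (hr : 0 < r) (ht : 0 ≤ t) :
    |Real.log (1 + Real.exp (-(2 * r * t)) * L) / (2 * r) -
      max (Real.log (max 1 L) / (2 * r) - t) 0| ≤ Real.log 2 / (2 * r) := by
  set u := Real.exp (-(2 * r * t)) with hu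
  have hu0 : 0 < u := Real.exp_pos _
  have hu1 : u ≤ 1 := Real.exp_le_one_iff.2 (by have : 0 ≤ 2 * r * t := by positivity
                                                linarith)
  have h1 : max (Real.log (max 1 L) / (2 * r) - t) 0 = Real.log (max 1 (u * L)) / (2 * r) := by
    have e1 : Real.log (max 1 L) / (2 * r) - t = Real.log (u * max 1 L) / (2 * r) := by
      rw [Real.log_mul hu0.ne' (by positivity), hu, Real.log_exp]; field_simp; ring
    rw [e1]
    rcases le_total 1 (u * max 1 L) with h | h
    · have : u * L = u * max 1 L ∨ u * max 1 L = 1 := by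
        rcases le_total 1 L with hl | hl
        · left; rw [max_eq_right hl]
        · right; rw [max_eq_left hl] at h ⊢; linarith
      rw [max_eq_left (div_nonneg (Real.log_nonneg h) (by positivity))]
      rcases this with h' | h'
      · rw [h', max_eq_right h]
      · have : u * L ≤ u * max 1 L := by gcongr; exact le_max_right _ _
        rw [max_eq_left (by linarith : u * L ≤ 1), h']
    · have : u * L ≤ u * max 1 L := by gcongr; exact le_max_right _ _
      rw [max_eq_left (this.trans h), Real.log_one, zero_div, max_eq_right]
      exact div_nonpos_of_nonpos_of_nonneg (Real.log_nonpos (by positivity) h) (by positivity)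
  rw [h1, ← sub_div, abs_div, abs_of_pos (by positivity : 0 < 2 * r)]
  gcongr
  have hz : 0 ≤ u * L := by positivity
  have m1 : max 1 (u * L) ≤ 1 + u * L := max_le (by linarith) (by linarith)
  have m2 : 1 + u * L ≤ 2 * max 1 (u * L) := by
    linarith [le_max_left 1 (u * L), le_max_right 1 (u * L)]
  have m0 : 0 < max 1 (u * L) := by positivity
  have l1 := Real.log_le_log m0 m1
  have l2 := Real.log_le_log (by positivity) m2
  rw [Real.log_mul (by norm_num) m0.ne'] at l2
  rw [abs_le]; constructor <;> linarith [Real.log_pos one_lt_two]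

end ConvPart

section SVPart
open Topology Matrix

lemma gram_norm {p : ℕ} (X : Matrix (Fin p) (Fin p) ℝ) (h : (Xᵀ * X).IsHermitian)
    (v : EuclideanSpace ℝ (Fin p)) :
    ‖toEuclideanCLM (𝕜 := ℝ) X v‖ ^ 2 =
      ∑ i, h.eigenvalues i * (inner ℝ (h.eigenvectorBasis i) v) ^ 2 := by
  have h1 : ‖toEuclideanCLM (𝕜 := ℝ) X v‖ ^ 2 =
      inner ℝ v (toEuclideanCLM (𝕜 := ℝ) (Xᵀ * X) v) := by
    have e : (Xᵀ * X) = star X * X := by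
      rw [Matrix.star_eq_conjTranspose]; simp
    rw [e, map_mul, map_star, mul_apply_eq_comp,
      ContinuousLinearMap.star_eq_adjoint, ContinuousLinearMap.adjoint_inner_right,
      real_inner_self_eq_norm_sq]
  rw [h1, ← OrthonormalBasis.sum_inner_mul_inner h.eigenvectorBasis]
  refine Finset.sum_congr rfl fun i _ => ?_
  have h2 : inner ℝ (h.eigenvectorBasis i) (toEuclideanCLM (𝕜 := ℝ) (Xᵀ * X) v) =
      h.eigenvalues i * inner ℝ (h.eigenvectorBasis i) v := by
    have hs : star (Xᵀ * X) = Xᵀ * X := by rw [Matrix.star_eq_conjTranspose]; exact h.eq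
    have e3 : toEuclideanCLM (𝕜 := ℝ) (Xᵀ * X) (h.eigenvectorBasis i) =
        h.eigenvalues i • h.eigenvectorBasis i := by
      apply WithLp.ofLp_injective
      rw [ofLp_toEuclideanCLM]
      simpa using h.mulVec_eigenvectorBasis i
    have hadj : ContinuousLinearMap.adjoint (toEuclideanCLM (𝕜 := ℝ) (Xᵀ * X)) =
        toEuclideanCLM (𝕜 := ℝ) (Xᵀ * X) := by
      rw [← ContinuousLinearMap.star_eq_adjoint, ← map_star, hs]
    rw [← hadj, ContinuousLinearMap.adjoint_inner_right, e3, real_inner_smul_left]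
  rw [h2, real_inner_comm]; ring

lemma sv_exponents {p : ℕ} (M : ℕ → Matrix (Fin p) (Fin p) ℝ)
    (h : ∀ t : ℚ, 0 ≤ t → ∃ γ, Tendsto (fun n : ℕ =>
      Real.log (gramDet (Real.exp (-(n * t)) • M n)) / n) atTop (𝓝 γ)) :
    ∃ (b : ℕ → OrthonormalBasis (Fin p) ℝ (EuclideanSpace ℝ (Fin p))) (s : ℕ → Fin p → ℝ)
      (χ : Fin p → ℝ), (∀ n i, 0 ≤ s n i) ∧
      (∀ n v, ‖toEuclideanCLM (𝕜 := ℝ) (M n) v‖ ^ 2 =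
        ∑ i, (s n i) ^ 2 * (inner ℝ (b n i) v) ^ 2) ∧
      (∀ i, ∀ ε > 0, ∀ᶠ n : ℕ in atTop, s n i ≤ Real.exp (n * (χ i + ε))) ∧
      (∀ i, 0 < χ i → ∀ ε > 0, ∀ᶠ n : ℕ in atTop, Real.exp (n * (χ i - ε)) ≤ s n i) := by
  have hps : ∀ n, ((M n)ᵀ * M n).PosSemidef := fun n => by
    simpa using Matrix.posSemidef_conjTranspose_mul_self (M n)
  have hH : ∀ n, ((M n)ᵀ * M n).IsHermitian := fun n => (hps n).isHermitian
  set lam : ℕ → Fin p → ℝ := fun n i => (hH n).eigenvalues i with hlam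
  have hlam0 : ∀ n i, 0 ≤ lam n i := fun n i => (hps n).eigenvalues_nonneg i
  set y : ℕ → Fin p → ℝ := fun n i => Real.log (max 1 (lam n i)) / (2 * n) with hy
  have hy0 : ∀ n i, 0 ≤ y n i := fun n i =>
    div_nonneg (Real.log_nonneg (le_max_left _ _)) (by positivity)
  have hdet : ∀ n : ℕ, ∀ t : ℝ, Real.log (gramDet (Real.exp (-(n * t)) • M n)) =
      ∑ i, Real.log (1 + Real.exp (-(2 * n * t)) * lam n i) := by
    intro n t
    have e1 : gramDet (Real.exp (-(n * t)) • M n) =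
        ∏ i, (1 + Real.exp (-(2 * n * t)) * lam n i) := by
      unfold gramDet
      rw [← det_one_add_smul_eq (hH n)]
      congr 2
      rw [Matrix.transpose_smul, Matrix.smul_mul, Matrix.mul_smul, smul_smul, ← Real.exp_add]
      congr 2; ring
    rw [e1, Real.log_prod]
    intro i _
    have := mul_nonneg (Real.exp_pos (-(2 * n * t))).le (hlam0 n i)
    positivity
  have hconv : ∀ t : ℚ, 0 ≤ t → ∃ γ, Tendsto (fun n => ∑ i, max (y n i - t) 0) atTop (𝓝 γ) := by
    intro t ht
    obtain ⟨γ, hγ⟩ := h t ht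
    refine ⟨γ / 2, ?_⟩
    have ht' : (0 : ℝ) ≤ t := by exact_mod_cast ht
    have h1 : Tendsto (fun n : ℕ => (p : ℝ) * (Real.log 2 / (2 * (n : ℝ)))) atTop (𝓝 0) := by
      have := (tendsto_const_div_atTop_nhds_zero_nat (Real.log 2 / 2)).const_mul (p : ℝ)
      rw [mul_zero] at this
      refine this.congr fun n => ?_
      rw [div_div]
    have h2 : Tendsto (fun n : ℕ => (∑ i, max (y n i - t) 0) -
        Real.log (gramDet (Real.exp (-(n * t)) • M n)) / n / 2) atTop (𝓝 0) := by
      refine squeeze_zero_norm' ?_ h1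
      filter_upwards [eventually_gt_atTop 0] with n hn
      have hn' : (0 : ℝ) < n := by exact_mod_cast hn
      rw [hdet, div_div, mul_comm (n : ℝ) 2, Finset.sum_div, ← Finset.sum_sub_distrib,
        Real.norm_eq_abs]
      refine (Finset.abs_sum_le_sum_abs _ _).trans ?_
      refine (Finset.sum_le_card_nsmul _ _ (Real.log 2 / (2 * n)) fun i _ => ?_).trans_eq (by simp)
      rw [abs_sub_comm]
      exact log_trunc (hlam0 n i) hn' ht'
    have h3 := h2.add (hγ.div_const 2)
    simpa using h3
  -- reorder
  set e : Fin (Fintype.card (Fin p)) ≃ Fin p := Fintype.equivOfCardEq (Fintype.card_fin _) with he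
  have hlame : ∀ n k, lam n (e k) = (hH n).eigenvalues₀ k := by
    intro n k
    simp only [hlam, Matrix.IsHermitian.eigenvalues]
    congr 1
    exact e.symm_apply_apply k
  obtain ⟨χ₀, hχ₀⟩ := conv_of_trunc (fun n k => y n (e k)) (fun n k => hy0 n _) (by
      intro n k l hkl
      simp only [hy, hlame]
      have := (hH n).eigenvalues₀_antitone hkl
      gcongr) (by
      intro t ht
      obtain ⟨γ, hγ⟩ := hconv t ht
      refine ⟨γ, hγ.congr fun n => ?_⟩
      exact (Equiv.sum_comp e (fun i => max (y n i - t) 0)).symm)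
  set χ : Fin p → ℝ := fun i => χ₀ (e.symm i) with hχ
  have hlim : ∀ i, Tendsto (fun n => y n i) atTop (𝓝 (χ i)) := by
    intro i
    have := hχ₀ (e.symm i)
    simpa using this
  refine ⟨fun n => (hH n).eigenvectorBasis, fun n i => Real.sqrt (lam n i), χ,
    fun n i => Real.sqrt_nonneg _, ?_, ?_, ?_⟩
  · intro n v
    rw [gram_norm _ (hH n)]
    refine Finset.sum_congr rfl fun i _ => ?_
    rw [Real.sq_sqrt (hlam0 n i)]
  · intro i ε hε
    have h1 : ∀ᶠ n in atTop, y n i < χ i + ε := (hlim i).eventually (gt_mem_nhds (by linarith))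
    filter_upwards [h1, eventually_gt_atTop 0] with n hn hn0
    have hn' : (0 : ℝ) < n := by exact_mod_cast hn0
    rw [hy] at hn
    simp only at hn
    rw [div_lt_iff₀ (by positivity), Real.log_lt_iff_lt_exp (by positivity)] at hn
    rw [Real.sqrt_le_left (Real.exp_pos _).le, ← Real.exp_nat_mul]
    refine (le_max_right _ _).trans (hn.le.trans_eq ?_)
    congr 1; push_cast; ring
  · intro i hi ε hε
    have h1 : ∀ᶠ n in atTop, χ i - ε < y n i := (hlim i).eventually (lt_mem_nhds (by linarith))
    have h2 : ∀ᶠ n in atTop, 0 < y n i := (hlim i).eventually (lt_mem_nhds hi)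
    filter_upwards [h1, h2, eventually_gt_atTop 0] with n hn hn2 hn0
    have hn' : (0 : ℝ) < n := by exact_mod_cast hn0
    simp only [hy] at hn hn2
    have h1l : 1 ≤ lam n i := by
      by_contra hlt
      push Not at hlt
      rw [max_eq_left hlt.le] at hn2
      simp at hn2
    rw [max_eq_right h1l, lt_div_iff₀ (by positivity),
      Real.lt_log_iff_exp_lt (by linarith)] at hn
    apply Real.le_sqrt_of_sq_le
    rw [← Real.exp_nat_mul]
    refine le_trans (le_of_eq ?_) hn.le
    congr 1; push_cast; ring

end SVPart

section CocyclePart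
open Topology Matrix

variable {α : Type*} {p : ℕ}

lemma cocycleIter_add (T : α → α)
    (A : α → (EuclideanSpace ℝ (Fin p) ≃L[ℝ] EuclideanSpace ℝ (Fin p))) (m n : ℕ) (x : α)
    (w : EuclideanSpace ℝ (Fin p)) :
    cocycleIter T A (m + n) x w = cocycleIter T A n (T^[m] x) (cocycleIter T A m x w) := by
  induction m generalizing x w with
  | zero => simp [cocycleIter]
  | succ m ih =>
    rw [show m + 1 + n = (m + n) + 1 by ring]
    simp only [cocycleIter, ContinuousLinearEquiv.trans_apply, Function.iterate_succ_apply]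
    exact ih _ _

lemma cocycleIter_succ' (T : α → α)
    (A : α → (EuclideanSpace ℝ (Fin p) ≃L[ℝ] EuclideanSpace ℝ (Fin p))) (n : ℕ) (x : α)
    (w : EuclideanSpace ℝ (Fin p)) :
    cocycleIter T A (n + 1) x w = A (T^[n] x) (cocycleIter T A n x w) := by
  rw [cocycleIter_add]
  simp [cocycleIter]

lemma eucl_expand (L : EuclideanSpace ℝ (Fin p) ≃L[ℝ] EuclideanSpace ℝ (Fin p))
    (w : EuclideanSpace ℝ (Fin p)) : L w = ∑ i, w i • L (EuclideanSpace.basisFun (Fin p) ℝ i) := by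
  conv_lhs => rw [← (EuclideanSpace.basisFun (Fin p) ℝ).sum_repr w]
  rw [map_sum]
  simp

lemma cocycleIter_measurable [MeasurableSpace α] {T : α → α} (hT : Measurable T)
    {A : α → (EuclideanSpace ℝ (Fin p) ≃L[ℝ] EuclideanSpace ℝ (Fin p))}
    (hA : ∀ w, Measurable fun x => A x w) (n : ℕ) (w : EuclideanSpace ℝ (Fin p)) :
    Measurable fun x => cocycleIter T A n x w := by
  induction n with
  | zero => simp only [cocycleIter]; exact measurable_const
  | succ n ih =>
    simp only [cocycleIter_succ']
    have : (fun x => A (T^[n] x) (cocycleIter T A n x w)) = fun x => ∑ i,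
        (cocycleIter T A n x w) i • A (T^[n] x) (EuclideanSpace.basisFun (Fin p) ℝ i) := by
      funext x; exact eucl_expand _ _
    rw [this]
    refine Finset.measurable_sum _ fun i _ => ?_
    have hc : Measurable fun v : EuclideanSpace ℝ (Fin p) => v i :=
      Continuous.measurable (by fun_prop)
    have h1 := hc.comp ih
    have h2 := (hA (EuclideanSpace.basisFun (Fin p) ℝ i)).comp (hT.iterate n)
    exact Measurable.smul h1 h2

/-- a measurable majorant of the operator norm -/
noncomputable def colNorm (A : α → (EuclideanSpace ℝ (Fin p) ≃L[ℝ] EuclideanSpace ℝ (Fin p)))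
    (x : α) : ℝ := ∑ i, ‖A x (EuclideanSpace.basisFun (Fin p) ℝ i)‖

lemma colNorm_nonneg (A : α → (EuclideanSpace ℝ (Fin p) ≃L[ℝ] EuclideanSpace ℝ (Fin p)))
    (x : α) : 0 ≤ colNorm A x := Finset.sum_nonneg fun _ _ => norm_nonneg _

lemma colNorm_bound (A : α → (EuclideanSpace ℝ (Fin p) ≃L[ℝ] EuclideanSpace ℝ (Fin p)))
    (x : α) (w : EuclideanSpace ℝ (Fin p)) : ‖A x w‖ ≤ colNorm A x * ‖w‖ := by
  rw [eucl_expand, colNorm, Finset.sum_mul]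
  refine (norm_sum_le _ _).trans (Finset.sum_le_sum fun i _ => ?_)
  rw [norm_smul, mul_comm]
  gcongr
  exact PiLp.norm_apply_le w i

lemma colNorm_measurable [MeasurableSpace α]
    {A : α → (EuclideanSpace ℝ (Fin p) ≃L[ℝ] EuclideanSpace ℝ (Fin p))}
    (hA : ∀ w, Measurable fun x => A x w) : Measurable (colNorm A) :=
  Finset.measurable_sum _ fun _ _ => (hA _).norm

lemma log_colNorm_integrable [MeasurableSpace α] {μ : Measure α} [IsProbabilityMeasure μ]
    {A : α → (EuclideanSpace ℝ (Fin p) ≃L[ℝ] EuclideanSpace ℝ (Fin p))}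
    (hA : ∀ w, Measurable fun x => A x w)
    (hint : Integrable (fun x =>
      Real.log ‖(A x : EuclideanSpace ℝ (Fin p) →L[ℝ] EuclideanSpace ℝ (Fin p))‖) μ) :
    Integrable (fun x => Real.log (1 + colNorm A x)) μ := by
  have hm : Measurable fun x => Real.log (1 + colNorm A x) :=
    Real.measurable_log.comp (measurable_const.add (colNorm_measurable hA))
  refine Integrable.mono' (hint.abs.add (integrable_const (Real.log (1 + p) + Real.log 2)))
    hm.aestronglyMeasurable (ae_of_all _ fun x => ?_)
  have h0 := colNorm_nonneg A x
  rw [Real.norm_eq_abs, abs_of_nonneg (Real.log_nonneg (by linarith))]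
  simp only [Pi.add_apply]
  set z := ‖(A x : EuclideanSpace ℝ (Fin p) →L[ℝ] EuclideanSpace ℝ (Fin p))‖ with hz
  have hz0 : 0 ≤ z := norm_nonneg _
  have h1 : colNorm A x ≤ p * z := by
    refine (Finset.sum_le_card_nsmul _ _ z fun i _ => ?_).trans_eq (by simp)
    have := (A x : EuclideanSpace ℝ (Fin p) →L[ℝ] EuclideanSpace ℝ (Fin p)).le_opNorm
      (EuclideanSpace.basisFun (Fin p) ℝ i)
    simpa using this
  have h2 : 1 + colNorm A x ≤ (1 + p) * (1 + z) := by
    have : (0 : ℝ) ≤ p := Nat.cast_nonneg _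
    nlinarith
  have h3 : Real.log (1 + z) ≤ Real.log 2 + |Real.log z| := by
    rcases le_total 1 z with h | h
    · have := Real.log_le_log (by linarith) (by linarith : 1 + z ≤ 2 * z)
      rw [Real.log_mul (by norm_num) (by linarith)] at this
      linarith [le_abs_self (Real.log z)]
    · have := Real.log_le_log (by linarith) (by linarith : 1 + z ≤ 2)
      linarith [abs_nonneg (Real.log z)]
  have h4 := Real.log_le_log (by linarith) h2
  rw [Real.log_mul (by positivity) (by positivity)] at h4
  linarith

/-- matrix of the iterate -/
noncomputable def iterMat (T : α → α)
    (A : α → (EuclideanSpace ℝ (Fin p) ≃L[ℝ] EuclideanSpace ℝ (Fin p))) (n : ℕ) (x : α) :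
    Matrix (Fin p) (Fin p) ℝ :=
  (toEuclideanCLM (n := Fin p) (𝕜 := ℝ)).symm
    (cocycleIter T A n x : EuclideanSpace ℝ (Fin p) →L[ℝ] EuclideanSpace ℝ (Fin p))

lemma toCLM_iterMat (T : α → α)
    (A : α → (EuclideanSpace ℝ (Fin p) ≃L[ℝ] EuclideanSpace ℝ (Fin p))) (n : ℕ) (x : α) :
    toEuclideanCLM (n := Fin p) (𝕜 := ℝ) (iterMat T A n x) =
    (cocycleIter T A n x : EuclideanSpace ℝ (Fin p) →L[ℝ] EuclideanSpace ℝ (Fin p)) :=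
  StarAlgEquiv.apply_symm_apply _ _

lemma iterMat_apply (T : α → α)
    (A : α → (EuclideanSpace ℝ (Fin p) ≃L[ℝ] EuclideanSpace ℝ (Fin p))) (n : ℕ) (x : α)
    (i j : Fin p) :
    iterMat T A n x i j = (cocycleIter T A n x (EuclideanSpace.basisFun (Fin p) ℝ j)) i := by
  have h := congrArg (fun L : EuclideanSpace ℝ (Fin p) →L[ℝ] EuclideanSpace ℝ (Fin p) =>
    (L (EuclideanSpace.basisFun (Fin p) ℝ j)).ofLp i) (toCLM_iterMat T A n x)
  simp only [ofLp_toEuclideanCLM] at h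
  simpa using h

lemma iterMat_add (T : α → α)
    (A : α → (EuclideanSpace ℝ (Fin p) ≃L[ℝ] EuclideanSpace ℝ (Fin p))) (m n : ℕ) (x : α) :
    iterMat T A (m + n) x = iterMat T A n (T^[m] x) * iterMat T A m x := by
  apply EquivLike.injective (toEuclideanCLM (n := Fin p) (𝕜 := ℝ))
  rw [map_mul, toCLM_iterMat, toCLM_iterMat, toCLM_iterMat]
  ext1 w
  exact cocycleIter_add T A m n x w

lemma det_measurable' [MeasurableSpace α] {F : α → Matrix (Fin p) (Fin p) ℝ}
    (hF : ∀ i j, Measurable fun x => F x i j) : Measurable fun x => (F x).det := by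
  simp only [Matrix.det_apply']
  exact Finset.measurable_sum _ fun σ _ => measurable_const.mul
    (Finset.measurable_prod _ fun i _ => hF _ _)

lemma log_gramDet_le (X : Matrix (Fin p) (Fin p) ℝ) {C : ℝ} (hC : 0 ≤ C)
    (h : ∀ v, ‖toEuclideanCLM (n := Fin p) (𝕜 := ℝ) X v‖ ≤ C * ‖v‖) :
    Real.log (gramDet X) ≤ p * (2 * Real.log (1 + C)) := by
  have hps : (Xᵀ * X).PosSemidef := by simpa using Matrix.posSemidef_conjTranspose_mul_self X
  have hH := hps.isHermitian
  have e1 : gramDet X = ∏ i, (1 + hH.eigenvalues i) := by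
    have := det_one_add_smul_eq hH 1
    simpa [gramDet] using this
  have h0 := fun i => hps.eigenvalues_nonneg i
  rw [e1, Real.log_prod (fun i _ => by linarith [h0 i])]
  refine (Finset.sum_le_card_nsmul _ _ (2 * Real.log (1 + C)) fun i _ => ?_).trans_eq (by simp)
  have h1 : hH.eigenvalues i ≤ C ^ 2 := by
    have e := gram_norm X hH (hH.eigenvectorBasis i)
    have e2 : ∑ j, hH.eigenvalues j * (inner ℝ (hH.eigenvectorBasis j) (hH.eigenvectorBasis i)) ^ 2
        = hH.eigenvalues i := by
      rw [Finset.sum_eq_single i]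
      · simp [hH.eigenvectorBasis.orthonormal.1 i]
      · intro j _ hj
        rw [hH.eigenvectorBasis.orthonormal.2 hj]; simp
      · simp
    rw [← e2, ← e]
    have := h (hH.eigenvectorBasis i)
    rw [hH.eigenvectorBasis.orthonormal.1 i, mul_one] at this
    gcongr
  rw [show 2 * Real.log (1 + C) = Real.log ((1 + C) ^ 2) by rw [Real.log_pow]; norm_num]
  exact Real.log_le_log (by linarith [h0 i]) (by nlinarith)

lemma kingman_gram [MeasurableSpace α] {μ : Measure α} [IsProbabilityMeasure μ]
    {T : α → α} (hT : Ergodic T μ)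
    {A : α → (EuclideanSpace ℝ (Fin p) ≃L[ℝ] EuclideanSpace ℝ (Fin p))}
    (hA : ∀ w, Measurable fun x => A x w)
    (hint : Integrable (fun x => Real.log (1 + colNorm A x)) μ) {t : ℝ} (ht : 0 ≤ t) :
    ∃ γ, ∀ᵐ x ∂μ, Tendsto (fun n : ℕ =>
      Real.log (gramDet (Real.exp (-(n * t)) • iterMat T A n x)) / n) atTop (𝓝 γ) := by
  have hm : ∀ n : ℕ, Measurable fun x =>
      Real.log (gramDet (Real.exp (-(n * t)) • iterMat T A n x)) := by
    intro n
    refine Real.measurable_log.comp (det_measurable' fun i j => ?_)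
    simp only [Matrix.add_apply, Matrix.mul_apply, Matrix.transpose_apply, Matrix.smul_apply,
      iterMat_apply, smul_eq_mul]
    have hc : ∀ i j, Measurable fun x =>
        (cocycleIter T A n x (EuclideanSpace.basisFun (Fin p) ℝ j)) i := by
      intro i j
      have hc : Measurable fun v : EuclideanSpace ℝ (Fin p) => v i :=
        Continuous.measurable (by fun_prop)
      exact hc.comp (cocycleIter_measurable hT.measurable hA n _)
    exact measurable_const.add (Finset.measurable_sum _ fun k _ =>
      (measurable_const.mul (hc _ _)).mul (measurable_const.mul (hc _ _)))
  refine kingman hT (g := fun n x => Real.log (gramDet (Real.exp (-(n * t)) • iterMat T A n x)))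
    hm (fun n x => Real.log_nonneg (gramDet_ge_one _)) ?_ ?_
  · refine Integrable.mono' ((hint.const_mul 2).const_mul p) (hm 1).aestronglyMeasurable
      (ae_of_all _ fun x => ?_)
    rw [Real.norm_eq_abs, abs_of_nonneg (Real.log_nonneg (gramDet_ge_one _))]
    refine log_gramDet_le _ (colNorm_nonneg A x) fun v => ?_
    rw [map_smul, toCLM_iterMat, _root_.smul_apply, norm_smul, Real.norm_eq_abs,
      abs_of_pos (Real.exp_pos _)]
    have h1 : Real.exp (-((1 : ℕ) * t)) ≤ 1 := Real.exp_le_one_iff.2 (by simpa using ht)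
    have h2 : ‖(cocycleIter T A 1 x) v‖ ≤ colNorm A x * ‖v‖ := by
      simpa [cocycleIter] using colNorm_bound A x v
    refine le_trans ?_ h2
    exact mul_le_of_le_one_left (norm_nonneg _) h1
  · intro m n x
    have e : Real.exp (-((m + n : ℕ) * t)) • iterMat T A (m + n) x =
        (Real.exp (-(n * t)) • iterMat T A n (T^[m] x)) *
          (Real.exp (-(m * t)) • iterMat T A m x) := by
      rw [iterMat_add, Matrix.smul_mul, Matrix.mul_smul, smul_smul, ← Real.exp_add]
      congr 2; push_cast; ring
    have h1 := gramDet_ge_one (Real.exp (-(n * t)) • iterMat T A n (T^[m] x))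
    have h2 := gramDet_ge_one (Real.exp (-(m * t)) • iterMat T A m x)
    rw [e, add_comm, ← Real.log_mul (by linarith) (by linarith)]
    have h3 := gramDet_ge_one ((Real.exp (-(n * t)) • iterMat T A n (T^[m] x)) *
      (Real.exp (-(m * t)) • iterMat T A m x))
    exact Real.log_le_log (by linarith) (gramDet_mul_le _ _)

lemma birkhoff_small [MeasurableSpace α] {μ : Measure α} [IsProbabilityMeasure μ]
    {T : α → α} (hT : Ergodic T μ) {f : α → ℝ} (hfm : Measurable f) (hf : Integrable f μ) :
    ∀ᵐ x ∂μ, ∀ ε > 0, ∀ᶠ n : ℕ in atTop, f (T^[n] x) ≤ n * ε := by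
  filter_upwards [birkhoff_tendsto hT hfm hf] with x hx ε hε
  set I := ∫ x, f x ∂μ with hI
  have h1 := hx (ε / 8) (by positivity)
  have h2 := (tendsto_add_atTop_nat 1).eventually h1
  have h3 : ∀ᶠ n : ℕ in atTop, |I| ≤ n * (ε / 8) :=
    (tendsto_natCast_atTop_atTop.atTop_mul_const (by positivity)).eventually_ge_atTop _
  filter_upwards [h1, h2, h3, eventually_ge_atTop 1] with n h1 h2 h3 hn
  rw [birkhoffSum_succ, abs_le] at h2
  rw [abs_le] at h1 h3
  push_cast at h2
  have : (1 : ℝ) ≤ n := by exact_mod_cast hn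
  nlinarith [h1.1, h2.2, h3.2, h3.1]

theorem growth_ae [MeasurableSpace α] {μ : Measure α} [IsProbabilityMeasure μ]
    {T : α → α} (hT : Ergodic T μ)
    {A : α → (EuclideanSpace ℝ (Fin p) ≃L[ℝ] EuclideanSpace ℝ (Fin p))}
    (hA : ∀ w, Measurable fun x => A x w)
    (hint : Integrable (fun x => Real.log (1 + colNorm A x)) μ) :
    ∀ᵐ x ∂μ, ∀ G : Submodule ℝ (EuclideanSpace ℝ (Fin p)),
      (∀ v ∈ G, (∀ ε > 0, ∀ᶠ n : ℕ in atTop,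
        ‖cocycleIter T A n x v‖ ≤ Real.exp (n * ε) * ‖v‖) → v = 0) →
      ∃ lam > 0, ∃ c > 0, ∀ᶠ n : ℕ in atTop, ∀ v ∈ G,
        c * Real.exp (n * lam) * ‖v‖ ≤ ‖cocycleIter T A n x v‖ := by
  have hK : ∀ᵐ x ∂μ, ∀ t : ℚ, 0 ≤ t → ∃ γ, Tendsto (fun n : ℕ =>
      Real.log (gramDet (Real.exp (-(n * t)) • iterMat T A n x)) / n) atTop (𝓝 γ) := by
    rw [ae_all_iff]; intro t
    by_cases ht : 0 ≤ t
    · obtain ⟨γ, hγ⟩ := kingman_gram hT hA hint (t := (t : ℝ)) (by exact_mod_cast ht)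
      filter_upwards [hγ] with x hx _
      exact ⟨γ, hx⟩
    · exact ae_of_all _ fun x h => absurd h ht
  have hm : Measurable fun x => Real.log (1 + colNorm A x) :=
    Real.measurable_log.comp (measurable_const.add (colNorm_measurable hA))
  filter_upwards [hK, birkhoff_small hT hm hint] with x hx hx2 G hG
  obtain ⟨b, s, χ, hs0, hB, hup, hlo⟩ := sv_exponents (fun n => iterMat T A n x) hx
  refine uniform_growth b s hs0
    (fun n => (cocycleIter T A n x : EuclideanSpace ℝ (Fin p) →L[ℝ] EuclideanSpace ℝ (Fin p)))
    ?_ (fun n => colNorm A (T^[n] x)) ?_ ?_ χ hup hlo G hG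
  · intro n v
    rw [← hB n v, toCLM_iterMat]
  · intro n v
    show ‖cocycleIter T A (n + 1) x v‖ ≤ colNorm A (T^[n] x) * ‖cocycleIter T A n x v‖
    rw [cocycleIter_succ']
    exact colNorm_bound A _ _
  · intro ε hε
    filter_upwards [hx2 ε hε] with n hn
    have h0 := colNorm_nonneg A (T^[n] x)
    rw [Real.log_le_iff_le_exp (by linarith)] at hn
    linarith

end CocyclePart

section CountPart
open Topology

/-- logarithmic bound for the number of admissible lattice points -/
noncomputable def latCount (p : ℕ) (δ a : ℝ) : ℝ :=
  if δ * (1 + a) < 1 / 2 then 0 else p * (Real.log 3 + Real.log (1 + a))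

lemma latCount_nonneg (p : ℕ) (δ : ℝ) {a : ℝ} (ha : 0 ≤ a) : 0 ≤ latCount p δ a := by
  unfold latCount
  split_ifs
  · exact le_rfl
  · have h1 := Real.log_nonneg (by norm_num : (1 : ℝ) ≤ 3)
    have h2 := Real.log_nonneg (by linarith : 1 ≤ 1 + a)
    positivity

lemma latCount_le (p : ℕ) (δ : ℝ) {a : ℝ} (ha : 0 ≤ a) :
    latCount p δ a ≤ p * (Real.log 3 + Real.log (1 + a)) := by
  unfold latCount
  split_ifs
  · have h1 := Real.log_nonneg (by norm_num : (1 : ℝ) ≤ 3)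
    have h2 := Real.log_nonneg (by linarith : 1 ≤ 1 + a)
    positivity
  · exact le_rfl

lemma lattice_eq {p : ℕ} {c c' : EuclideanSpace ℝ (Fin p)} (hc : c ∈ latticeZ p)
    (hc' : c' ∈ latticeZ p) (h : ‖c - c'‖ < 1) : c = c' := by
  ext i
  obtain ⟨k, hk⟩ := hc i
  obtain ⟨k', hk'⟩ := hc' i
  have h1 : |c i - c' i| < 1 := by
    have := PiLp.norm_apply_le (c - c') i
    rw [Real.norm_eq_abs] at this
    simp only [PiLp.sub_apply] at this
    linarith
  rw [hk, hk'] at h1 ⊢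
  have h2 : |k - k'| < 1 := by
    have h3 : ((|k - k'| : ℤ) : ℝ) < ((1 : ℤ) : ℝ) := by push_cast; exact h1
    exact_mod_cast h3
  have : k - k' = 0 := Int.abs_lt_one_iff.1 h2
  have : k = k' := by omega
  rw [this]

lemma lattice_ball {p : ℕ} {δ a : ℝ} (hδ : 0 < δ) (hδ1 : δ ≤ 1) (ha : 0 ≤ a)
    (v : EuclideanSpace ℝ (Fin p)) :
    ∃ F : Finset (EuclideanSpace ℝ (Fin p)), (F.card : ℝ) ≤ Real.exp (latCount p δ a) ∧
      ∀ c ∈ latticeZ p, ‖c - v‖ < δ * (1 + a) → c ∈ F := by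
  classical
  unfold latCount
  split_ifs with h
  · by_cases hex : ∃ c ∈ latticeZ p, ‖c - v‖ < δ * (1 + a)
    · obtain ⟨c, hc, hcv⟩ := hex
      refine ⟨{c}, by simp, fun c' hc' hcv' => ?_⟩
      rw [Finset.mem_singleton]
      refine lattice_eq hc' hc ?_
      calc ‖c' - c‖ = ‖(c' - v) - (c - v)‖ := by congr 1; abel
        _ ≤ ‖c' - v‖ + ‖c - v‖ := norm_sub_le _ _
        _ < 1 := by linarith
    · push Not at hex
      refine ⟨∅, by simp, fun c hc hcv => ?_⟩
      exact absurd hcv (not_lt.2 (hex c hc))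
  · set r := δ * (1 + a) with hr
    have hr0 : 0 < r := by positivity
    set J : Finset (Fin p → ℤ) :=
      Fintype.piFinset fun i => Finset.Icc ⌈v i - r⌉ ⌊v i + r⌋ with hJ
    refine ⟨J.image fun k => WithLp.toLp 2 fun i => (k i : ℝ), ?_, ?_⟩
    · have h1 : (J.card : ℝ) ≤ (3 * (1 + a)) ^ p := by
        rw [hJ, Fintype.card_piFinset, Nat.cast_prod]
        refine (Finset.prod_le_prod (fun _ _ => Nat.cast_nonneg _) (fun i _ => ?_)).trans_eq
          (show ∏ _i : Fin p, (3 * (1 + a)) = (3 * (1 + a)) ^ p by simp)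
        rw [Int.card_Icc]
        have e1 : (⌊v i + r⌋ : ℝ) ≤ v i + r := Int.floor_le _
        have e2 : v i - r ≤ (⌈v i - r⌉ : ℝ) := Int.le_ceil _
        have e3 : ((⌊v i + r⌋ + 1 - ⌈v i - r⌉ : ℤ) : ℝ) ≤ 3 * (1 + a) := by
          push_cast
          have : r ≤ 1 * (1 + a) := by rw [hr]; gcongr
          linarith
        have e4 : (((⌊v i + r⌋ + 1 - ⌈v i - r⌉ : ℤ).toNat : ℤ) : ℝ) ≤ 3 * (1 + a) := by
          rw [Int.toNat_eq_max, Int.cast_max]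
          exact max_le e3 (by simp; linarith)
        exact_mod_cast e4
      refine le_trans (by exact_mod_cast Finset.card_image_le) (h1.trans_eq ?_)
      rw [← Real.log_mul (by norm_num) (by linarith), ← Real.log_pow,
        Real.exp_log (by positivity)]
    · intro c hc hcv
      choose k hk using hc
      rw [Finset.mem_image]
      refine ⟨k, ?_, ?_⟩
      · rw [hJ, Fintype.mem_piFinset]
        intro i
        have h1 : |c i - v i| < r := by
          have := PiLp.norm_apply_le (c - v) i
          rw [Real.norm_eq_abs] at this
          simp only [PiLp.sub_apply] at this
          linarith
        rw [hk, abs_lt] at h1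
        rw [Finset.mem_Icc, Int.ceil_le, Int.le_floor]
        constructor <;> linarith
      · ext i; simp [hk]

lemma count_chain {p : ℕ} {δ : ℝ} (hδ : 0 < δ) (hδ1 : δ ≤ 1)
    (B L : ℕ → EuclideanSpace ℝ (Fin p) →L[ℝ] EuclideanSpace ℝ (Fin p))
    (hstep : ∀ n w, B (n + 1) w = L n (B n w)) (a : ℕ → ℝ) (ha0 : ∀ n, 0 ≤ a n)
    (hL : ∀ n v, ‖L n v‖ ≤ a n * ‖v‖) (N : ℕ) (c₀ : EuclideanSpace ℝ (Fin p)) (n : ℕ) :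
    ∃ P : Finset (EuclideanSpace ℝ (Fin p)),
      (P.card : ℝ) ≤ Real.exp (∑ k ∈ Finset.range n, latCount p δ (a (N + k))) ∧
      ∀ w, ‖B N w - c₀‖ < δ → (∀ k ≥ N, ∃ c ∈ latticeZ p, ‖B k w - c‖ < δ) →
        ∃ c ∈ P, ‖B (N + n) w - c‖ < δ := by
  classical
  induction n with
  | zero => exact ⟨{c₀}, by simp, fun w hw _ => ⟨c₀, by simp, hw⟩⟩
  | succ n ih =>
    obtain ⟨P, hP, hPw⟩ := ih
    choose F hF1 hF2 using fun c => lattice_ball (a := a (N + n)) hδ hδ1 (ha0 _) (L (N + n) c)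
    refine ⟨P.biUnion F, ?_, ?_⟩
    · rw [Finset.sum_range_succ, Real.exp_add]
      have h1 : ((P.biUnion F).card : ℝ) ≤ ∑ c ∈ P, ((F c).card : ℝ) := by
        exact_mod_cast Finset.card_biUnion_le
      have h2 : ∑ c ∈ P, ((F c).card : ℝ) ≤ P.card * Real.exp (latCount p δ (a (N + n))) :=
        (Finset.sum_le_card_nsmul _ _ _ fun c _ => hF1 c).trans_eq (by simp)
      exact (h1.trans h2).trans (by gcongr)
    · intro w hw hk
      obtain ⟨c, hc, hcw⟩ := hPw w hw hk
      obtain ⟨c', hc', hcw'⟩ := hk (N + n + 1) (by omega)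
      refine ⟨c', Finset.mem_biUnion.2 ⟨c, hc, hF2 c c' hc' ?_⟩, hcw'⟩
      have e : c' - L (N + n) c = (L (N + n) (B (N + n) w - c)) - (B (N + n + 1) w - c') := by
        rw [hstep, map_sub]; abel
      rw [e]
      have h1 := hL (N + n) (B (N + n) w - c)
      have h2 : a (N + n) * ‖B (N + n) w - c‖ ≤ a (N + n) * δ :=
        mul_le_mul_of_nonneg_left hcw.le (ha0 _)
      have h3 := norm_sub_le (L (N + n) (B (N + n) w - c)) (B (N + n + 1) w - c')
      nlinarith

lemma piece_dim {p : ℕ} {δ : ℝ} (hδ : 0 < δ) (hδ1 : δ ≤ 1)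
    (B L : ℕ → EuclideanSpace ℝ (Fin p) →L[ℝ] EuclideanSpace ℝ (Fin p))
    (hstep : ∀ n w, B (n + 1) w = L n (B n w)) (a : ℕ → ℝ) (ha0 : ∀ n, 0 ≤ a n)
    (hL : ∀ n v, ‖L n v‖ ≤ a n * ‖v‖)
    (G : Submodule ℝ (EuclideanSpace ℝ (Fin p))) {lam κ : ℝ} (hlam : 0 < lam)
    (hκ : 0 < κ)
    (hgr : ∀ᶠ n : ℕ in atTop, ∀ v ∈ G, κ * Real.exp (n * lam) * ‖v‖ ≤ ‖B n v‖)
    {d : NNReal}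
    (hcount : ∀ᶠ n : ℕ in atTop, ∑ k ∈ Finset.range n, latCount p δ (a k) ≤ n * (lam * d))
    (N : ℕ) (c₀ : EuclideanSpace ℝ (Fin p)) (S : Set (EuclideanSpace ℝ (Fin p)))
    (hSG : ∀ w ∈ S, ∀ w' ∈ S, w - w' ∈ G)
    (hS0 : ∀ w ∈ S, ‖B N w - c₀‖ < δ)
    (hS : ∀ w ∈ S, ∀ k ≥ N, ∃ c ∈ latticeZ p, ‖B k w - c‖ < δ) : dimH S ≤ d := by
  choose P hP1 hP2 using count_chain hδ hδ1 B L hstep a ha0 hL N c₀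
  apply dimH_le_of_hausdorffMeasure_ne_top
  -- the covering
  set t : ∀ n : ℕ, P n → Set (EuclideanSpace ℝ (Fin p)) :=
    fun n c => {w ∈ S | ‖B (N + n) w - c‖ < δ} with ht
  set q : ℕ → ℝ := fun n => 2 * δ / κ * Real.exp (-((N + n : ℕ) * lam)) with hq
  have hq0 : ∀ n, 0 ≤ q n := fun n => by simp only [hq]; positivity
  have hshift : Tendsto (fun n : ℕ => N + n) atTop atTop :=
    tendsto_atTop_mono (fun n => Nat.le_add_left n N) tendsto_id
  have hdiam : ∀ᶠ n in atTop, ∀ c, ediam (t n c) ≤ ENNReal.ofReal (q n) := by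
    filter_upwards [hshift.eventually hgr] with n hn c
    refine ediam_le fun w hw w' hw' => ?_
    rw [edist_dist]
    refine ENNReal.ofReal_le_ofReal ?_
    rw [dist_eq_norm]
    have h1 := hn (w - w') (hSG w hw.1 w' hw'.1)
    have h2 : ‖B (N + n) (w - w')‖ ≤ 2 * δ := by
      have e : B (N + n) (w - w') = (B (N + n) w - c) - (B (N + n) w' - c) := by
        rw [map_sub]; abel
      rw [e]
      have := norm_sub_le (B (N + n) w - c) (B (N + n) w' - c)
      linarith [hw.2, hw'.2]
    simp only [hq]
    rw [Real.exp_neg, ← div_eq_mul_inv, div_div, le_div_iff₀ (by positivity)]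
    linarith
  have hcov : ∀ n, S ⊆ ⋃ c, t n c := by
    intro n w hw
    obtain ⟨c, hc, hcw⟩ := hP2 n w (hS0 w hw) (hS w hw)
    exact Set.mem_iUnion.2 ⟨⟨c, hc⟩, hw, hcw⟩
  have hq_lim : Tendsto (fun n => ENNReal.ofReal (q n)) atTop (𝓝 0) := by
    rw [← ENNReal.ofReal_zero]
    refine (ENNReal.continuous_ofReal.tendsto 0).comp ?_
    have h1 : Tendsto (fun n : ℕ => ((N + n : ℕ) : ℝ) * lam) atTop atTop :=
      (tendsto_natCast_atTop_atTop.comp hshift).atTop_mul_const hlam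
    have h2 := (Real.tendsto_exp_neg_atTop_nhds_zero.comp h1).const_mul (2 * δ / κ)
    rw [mul_zero] at h2
    exact h2
  have hmain := Measure.hausdorffMeasure_le_liminf_sum (d : ℝ) S
    (fun n => ENNReal.ofReal (q n)) hq_lim t hdiam (Eventually.of_forall hcov)
  refine ne_top_of_le_ne_top (b := ENNReal.ofReal ((2 * δ / κ) ^ (d : ℝ))) ENNReal.ofReal_ne_top
    (hmain.trans ?_)
  refine liminf_le_of_frequently_le' (Eventually.frequently ?_)
  filter_upwards [hdiam, hshift.eventually hcount] with n hn hc
  have h1 : ∑ c, ediam (t n c) ^ (d : ℝ) ≤ (P n).card • ENNReal.ofReal (q n ^ (d : ℝ)) := by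
    refine (Finset.sum_le_card_nsmul _ _ (ENNReal.ofReal (q n ^ (d : ℝ))) fun c _ => ?_).trans_eq
      (by simp)
    rw [← ENNReal.ofReal_rpow_of_nonneg (hq0 n) d.coe_nonneg]
    exact ENNReal.rpow_le_rpow (hn c) d.coe_nonneg
  refine h1.trans ?_
  rw [nsmul_eq_mul, ← ENNReal.ofReal_natCast, ← ENNReal.ofReal_mul (Nat.cast_nonneg _)]
  refine ENNReal.ofReal_le_ofReal ?_
  have h2 : q n ^ (d : ℝ) = (2 * δ / κ) ^ (d : ℝ) * Real.exp (-((N + n : ℕ) * lam * d)) := by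
    simp only [hq]
    rw [Real.mul_rpow (by positivity) (Real.exp_pos _).le, ← Real.exp_mul]
    congr 2; ring
  have h3 : ((P n).card : ℝ) ≤ Real.exp ((N + n : ℕ) * (lam * d)) := by
    refine (hP1 n).trans (Real.exp_le_exp.2 (le_trans ?_ hc))
    rw [Finset.sum_range_add]
    have : 0 ≤ ∑ k ∈ Finset.range N, latCount p δ (a k) :=
      Finset.sum_nonneg fun k _ => latCount_nonneg p δ (ha0 k)
    linarith
  rw [h2]
  have h4 : (0 : ℝ) ≤ (2 * δ / κ) ^ (d : ℝ) := by positivity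
  calc ((P n).card : ℝ) * ((2 * δ / κ) ^ (d : ℝ) * Real.exp (-((N + n : ℕ) * lam * d)))
      ≤ Real.exp ((N + n : ℕ) * (lam * d)) *
        ((2 * δ / κ) ^ (d : ℝ) * Real.exp (-((N + n : ℕ) * lam * d))) := by gcongr
    _ = (2 * δ / κ) ^ (d : ℝ) * (Real.exp ((N + n : ℕ) * (lam * d)) *
        Real.exp (-((N + n : ℕ) * lam * d))) := by ring
    _ = (2 * δ / κ) ^ (d : ℝ) := by
      rw [← Real.exp_add]
      rw [show ((N + n : ℕ) : ℝ) * (lam * d) + -((N + n : ℕ) * lam * d) = 0 by ring]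
      simp

lemma slice_dim {p : ℕ}
    (B L : ℕ → EuclideanSpace ℝ (Fin p) →L[ℝ] EuclideanSpace ℝ (Fin p))
    (hstep : ∀ n w, B (n + 1) w = L n (B n w)) (a : ℕ → ℝ) (ha0 : ∀ n, 0 ≤ a n)
    (hL : ∀ n v, ‖L n v‖ ≤ a n * ‖v‖)
    (G : Submodule ℝ (EuclideanSpace ℝ (Fin p))) {lam κ : ℝ} (hlam : 0 < lam)
    (hκ : 0 < κ)
    (hgr : ∀ᶠ n : ℕ in atTop, ∀ v ∈ G, κ * Real.exp (n * lam) * ‖v‖ ≤ ‖B n v‖)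
    (hcount : ∀ ε > 0, ∃ δ > 0, δ ≤ 1 ∧
      ∀ᶠ n : ℕ in atTop, ∑ k ∈ Finset.range n, latCount p δ (a k) ≤ n * ε)
    (u : EuclideanSpace ℝ (Fin p)) :
    dimH ({w | ∃ g ∈ G, w = u + g} ∩
      {w | Tendsto (fun n : ℕ => infDist (B n w) (latticeZ p)) atTop (𝓝 0)}) = 0 := by
  have key : ∀ d : NNReal, 0 < d → dimH ({w | ∃ g ∈ G, w = u + g} ∩
      {w | Tendsto (fun n : ℕ => infDist (B n w) (latticeZ p)) atTop (𝓝 0)}) ≤ d := by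
    intro d hd
    have hd' : (0 : ℝ) < d := hd
    obtain ⟨δ, hδ, hδ1, hc⟩ := hcount (lam * d) (by positivity)
    set S : ℕ × (Fin p → ℤ) → Set (EuclideanSpace ℝ (Fin p)) := fun i =>
      {w | (∃ g ∈ G, w = u + g) ∧ ‖B i.1 w - WithLp.toLp 2 (fun j => (i.2 j : ℝ))‖ < δ ∧
        ∀ k ≥ i.1, ∃ c ∈ latticeZ p, ‖B k w - c‖ < δ} with hS
    have hne : (latticeZ p).Nonempty := ⟨0, fun i => ⟨0, by simp⟩⟩
    have hsub : ({w | ∃ g ∈ G, w = u + g} ∩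
      {w | Tendsto (fun n : ℕ => infDist (B n w) (latticeZ p)) atTop (𝓝 0)}) ⊆ ⋃ i, S i := by
      rintro w ⟨hw, hw2⟩
      have h1 : ∀ᶠ n : ℕ in atTop, infDist (B n w) (latticeZ p) < δ :=
        Tendsto.eventually hw2 (gt_mem_nhds hδ)
      obtain ⟨N, hN⟩ := eventually_atTop.1 h1
      have h2 : ∀ k ≥ N, ∃ c ∈ latticeZ p, ‖B k w - c‖ < δ := by
        intro k hk
        obtain ⟨c, hc, hd⟩ := (infDist_lt_iff hne).1 (hN k hk)
        exact ⟨c, hc, by rwa [← dist_eq_norm]⟩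
      obtain ⟨c, hc, hcd⟩ := h2 N le_rfl
      choose k hk using hc
      refine Set.mem_iUnion.2 ⟨(N, k), hw, ?_, h2⟩
      have : WithLp.toLp 2 (fun j => (k j : ℝ)) = c := by ext j; simp [hk]
      simp only
      rw [this]; exact hcd
    refine (dimH_mono hsub).trans ?_
    rw [dimH_iUnion]
    refine iSup_le fun i => ?_
    refine piece_dim hδ hδ1 B L hstep a ha0 hL G hlam hκ hgr hc i.1
      (WithLp.toLp 2 (fun j => (i.2 j : ℝ))) (S i) ?_ (fun w hw => hw.2.1) (fun w hw => hw.2.2)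
    rintro w ⟨⟨g, hg, rfl⟩, -⟩ w' ⟨⟨g', hg', rfl⟩, -⟩
    rw [add_sub_add_left_eq_sub]
    exact G.sub_mem hg hg'
  refine nonpos_iff_eq_zero.1 ?_
  refine ENNReal.le_of_forall_pos_le_add fun ε hε _ => ?_
  rw [zero_add]; exact key ε hε

end CountPart

section FinalPart
open Topology

lemma mem_centralStable {α : Type*} {p : ℕ} (T : α → α)
    (A : α → (EuclideanSpace ℝ (Fin p) ≃L[ℝ] EuclideanSpace ℝ (Fin p))) (x : α)
    (v : EuclideanSpace ℝ (Fin p))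
    (h : ∀ ε > 0, ∀ᶠ n : ℕ in atTop, ‖cocycleIter T A n x v‖ ≤ Real.exp (n * ε) * ‖v‖) :
    v ∈ centralStable T A x := by
  show limsup (fun n : ℕ => ‖cocycleIter T A n x v‖ ^ ((1 : ℝ) / n)) atTop ≤ 1
  refine le_of_forall_pos_le_add fun η hη => ?_
  have hb : IsBoundedUnder (· ≥ ·) atTop
      (fun n : ℕ => ‖cocycleIter T A n x v‖ ^ ((1 : ℝ) / n)) :=
    isBoundedUnder_of ⟨0, fun n => by positivity⟩
  refine limsup_le_of_le hb.isCoboundedUnder_le ?_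
  have hl : 0 < Real.log (1 + η) := Real.log_pos (by linarith)
  set ε := Real.log (1 + η) / 2 with hε
  have hε0 : 0 < ε := by positivity
  have h2 : ∀ᶠ n : ℕ in atTop, ‖v‖ ≤ Real.exp (n * ε) := by
    have := Real.tendsto_exp_atTop.comp
      ((tendsto_natCast_atTop_atTop (R := ℝ)).atTop_mul_const hε0)
    exact this.eventually_ge_atTop _
  filter_upwards [h ε hε0, h2, eventually_gt_atTop 0] with n h1 h2 hn
  have hn' : (0 : ℝ) < n := by exact_mod_cast hn
  have h3 : ‖cocycleIter T A n x v‖ ≤ Real.exp (n * Real.log (1 + η)) := by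
    refine h1.trans ((mul_le_mul_of_nonneg_left h2 (Real.exp_pos _).le).trans_eq ?_)
    rw [← Real.exp_add]; congr 1; rw [hε]; ring
  refine (Real.rpow_le_rpow (norm_nonneg _) h3 (by positivity)).trans_eq ?_
  rw [← Real.exp_mul, show (n : ℝ) * Real.log (1 + η) * (1 / n) = Real.log (1 + η) by field_simp,
    Real.exp_log (by linarith), add_comm]

lemma latCount_measurable (p : ℕ) (δ : ℝ) : Measurable (latCount p δ) := by
  unfold latCount
  refine Measurable.ite ?_ measurable_const ?_
  · exact measurableSet_lt (by fun_prop) measurable_const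
  · exact measurable_const.mul (measurable_const.add
      (Real.measurable_log.comp (by fun_prop)))

lemma count_ae {α : Type*} {p : ℕ} [MeasurableSpace α] {μ : Measure α} [IsProbabilityMeasure μ]
    {T : α → α} (hT : Ergodic T μ) {a : α → ℝ} (ham : Measurable a) (ha0 : ∀ x, 0 ≤ a x)
    (hint : Integrable (fun x => Real.log (1 + a x)) μ) :
    ∀ᵐ x ∂μ, ∀ ε > 0, ∃ δ > 0, δ ≤ 1 ∧
      ∀ᶠ n : ℕ in atTop, ∑ k ∈ Finset.range n, latCount p δ (a (T^[k] x)) ≤ n * ε := by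
  set dl : ℕ → ℝ := fun j => 1 / ((j : ℝ) + 1) with hdl
  have hm : ∀ δ, Measurable fun x => latCount p δ (a x) := fun δ =>
    (latCount_measurable p δ).comp ham
  have hdom : Integrable (fun x => p * (Real.log 3 + Real.log (1 + a x))) μ :=
    ((integrable_const _).add hint).const_mul _
  have hb : ∀ δ x, ‖latCount p δ (a x)‖ ≤ p * (Real.log 3 + Real.log (1 + a x)) := by
    intro δ x
    rw [Real.norm_eq_abs, abs_of_nonneg (latCount_nonneg p δ (ha0 x))]
    exact latCount_le p δ (ha0 x)
  have hi : ∀ δ, Integrable (fun x => latCount p δ (a x)) μ := fun δ =>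
    hdom.mono' (hm δ).aestronglyMeasurable (ae_of_all _ (hb δ))
  have hlim : Tendsto (fun j => ∫ x, latCount p (dl j) (a x) ∂μ) atTop (𝓝 0) := by
    have := tendsto_integral_of_dominated_convergence (μ := μ)
      (F := fun j x => latCount p (dl j) (a x)) (f := fun _ => (0 : ℝ))
      (fun x => p * (Real.log 3 + Real.log (1 + a x)))
      (fun j => (hm _).aestronglyMeasurable) hdom (fun j => ae_of_all _ (hb _))
      (ae_of_all _ fun x => by
        refine tendsto_const_nhds.congr' ?_
        have h1 : Tendsto (fun j => dl j * (1 + a x)) atTop (𝓝 0) := by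
          have := (tendsto_one_div_add_atTop_nhds_zero_nat (𝕜 := ℝ)).mul_const (1 + a x)
          rwa [zero_mul] at this
        filter_upwards [h1.eventually (gt_mem_nhds (by norm_num : (0 : ℝ) < 1 / 2))] with j hj
        simp [latCount]
        intro h
        exact absurd hj (by norm_num; linarith))
    simpa using this
  have hall : ∀ᵐ x ∂μ, ∀ j k : ℕ, ∫ x, latCount p (dl j) (a x) ∂μ < dl k →
      ∀ᶠ n : ℕ in atTop, birkhoffSum T (fun x => latCount p (dl j) (a x)) n x ≤ n * dl k := by
    rw [ae_all_iff]; intro j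
    rw [ae_all_iff]; intro k
    by_cases h : ∫ x, latCount p (dl j) (a x) ∂μ < dl k
    · filter_upwards [birkhoff_upper hT (hm (dl j)) (hi (dl j)) h] with x hx _
      exact hx
    · exact ae_of_all _ fun x h' => absurd h' h
  filter_upwards [hall] with x hx ε hε
  obtain ⟨k, hk⟩ := exists_nat_one_div_lt hε
  have hk0 : 0 < dl k := by simp only [hdl]; positivity
  obtain ⟨j, hj⟩ := (hlim.eventually (gt_mem_nhds hk0)).exists
  refine ⟨dl j, by simp only [hdl]; positivity, ?_, ?_⟩
  · simp only [hdl]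
    rw [div_le_one (by positivity)]
    linarith [(Nat.cast_nonneg j : (0 : ℝ) ≤ j)]
  · filter_upwards [hx j k hj] with n hn
    refine le_trans ?_ (hn.trans ?_)
    · exact le_rfl
    · have : dl k ≤ ε := hk.le
      gcongr

end FinalPart

/-- Linear exclusion: for a measurable cocycle `(T,A)` over an ergodic system, for a.e. `x`,
if `G` is an affine subspace parallel to a linear subspace `G₀` transverse to the central
stable space `E^{cs}(x)`, then the Hausdorff dimension of `G ∩ W^s(x)` is `0`. -/
theorem hausdorff_dim_weak_stable_slice_zero
    {α : Type*} [MeasurableSpace α] {p : ℕ}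
    (μ : Measure α) [IsProbabilityMeasure μ]
    (T : α → α) (hT : Ergodic T μ)
    (A : α → (EuclideanSpace ℝ (Fin p) ≃L[ℝ] EuclideanSpace ℝ (Fin p)))
    (hAmeas : ∀ w : EuclideanSpace ℝ (Fin p), Measurable fun x => A x w)
    (hint : Integrable (fun x =>
      Real.log ‖(A x : EuclideanSpace ℝ (Fin p) →L[ℝ] EuclideanSpace ℝ (Fin p))‖) μ) :
    ∀ᵐ x ∂μ, ∀ (G₀ : Submodule ℝ (EuclideanSpace ℝ (Fin p))) (u : EuclideanSpace ℝ (Fin p)),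
      -- G₀ transverse to E^{cs}(x)
      (∀ w ∈ G₀, w ∈ centralStable T A x → w = 0) →
      (G₀ ⊔ Submodule.span ℝ (centralStable T A x) = ⊤) →
      dimH ({w | ∃ g ∈ G₀, w = u + g} ∩ weakStable T A x) = 0 := by
  have hlog := log_colNorm_integrable hAmeas hint
  filter_upwards [growth_ae hT hAmeas hlog,
    count_ae (p := p) hT (colNorm_measurable hAmeas) (colNorm_nonneg A) hlog]
    with x hx1 hx2 G₀ u hG _
  obtain ⟨lam, hlam, κ, hκ, hgr⟩ := hx1 G₀ fun v hv hs => hG v hv (mem_centralStable T A x v hs)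
  exact slice_dim
    (fun n => (cocycleIter T A n x : EuclideanSpace ℝ (Fin p) →L[ℝ] EuclideanSpace ℝ (Fin p)))
    (fun n => (A (T^[n] x) : EuclideanSpace ℝ (Fin p) →L[ℝ] EuclideanSpace ℝ (Fin p)))
    (fun n w => cocycleIter_succ' T A n x w) (fun n => colNorm A (T^[n] x))
    (fun n => colNorm_nonneg A _) (fun n v => colNorm_bound A _ v) G₀ hlam hκ hgr hx2 u
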